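/- Let f ∈ Dom_+(Γ) with f → ∞, let p ≥ 2 and a > 0, write A := {f ≤ a}, and set X_t := f(ξ_t). Assume f^p ∈ Dom_+(Γ) and that there exists c > 0 with Γf^p(x) ≤ −c·f(x)^{p−2} for all x ∉ A. Then the process Z_t := (X_{t∧τ_A}² + (2c/p)·(t∧τ_A))^{p/2} is a nonnegative supermartingale. -/

import Mathlib

open MeasureTheory Set Filter
open scoped Classical ENNReal NNReal

/-- A continuous-time Markov chain on a countably infinite state space `X`,
described by its generator `Γ`, together with a probability space carrying,
for each starting point `x`, the embedded jump chain `jump` and the holding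
times `hold` (with `hold n` the holding time at the `n`-th visited state). -/
structure CTMC where
  X : Type
  countX : Countable X
  infX : Infinite X
  Γ : X → X → ℝ
  γ : X → ℝ
  γ_pos : ∀ x, 0 < γ x
  Γ_offdiag_nonneg : ∀ x y, y ≠ x → 0 ≤ Γ x y
  Γ_diag : ∀ x, Γ x x = - γ x
  γ_sum : ∀ x, HasSum (fun y => if y = x then 0 else Γ x y) (γ x)
  /-- irreducibility of the embedded jump chain -/
  irr : ∀ x y : X, ∃ (n : ℕ) (path : ℕ → X), path 0 = x ∧ path n = y ∧
    ∀ k, k < n → 0 < (if path (k+1) = path k then 0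
      else Γ (path k) (path (k+1)) / γ (path k))
  Ω : Type
  measΩ : MeasurableSpace Ω
  μ : X → @Measure Ω measΩ
  probμ : ∀ x, @IsProbabilityMeasure Ω measΩ (μ x)
  jump : ℕ → Ω → X
  hold : ℕ → Ω → ℝ
  jump_meas : ∀ (n : ℕ) (x : X), MeasurableSet[measΩ] {ω | jump n ω = x}
  hold_meas : ∀ n : ℕ, @Measurable Ω ℝ measΩ _ (hold n)
  hold_pos : ∀ n ω, 0 < hold n ω
  /-- under `μ x` the chain starts at `x` -/
  start : ∀ x : X, μ x {ω | jump 0 ω = x} = 1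
  /-- finite-dimensional law: the embedded chain is Markov with transition
  probabilities `P x y = Γ x y / γ x` (for `y ≠ x`), and conditionally on the
  embedded chain the holding times are independent exponentials of rates
  `γ (jump n)` -/
  law : ∀ (x : X) (n : ℕ) (path : ℕ → X) (t : ℕ → ℝ), path 0 = x → (∀ k, 0 ≤ t k) →
    μ x {ω | (∀ k, k ≤ n → jump k ω = path k) ∧ (∀ k, k < n → t k < hold k ω)}
      = ENNReal.ofReal (∏ k ∈ Finset.range n,
          ((if path (k+1) = path k then 0 else Γ (path k) (path (k+1)) / γ (path k))
            * Real.exp (-(γ (path k)) * t k)))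

namespace CTMC

attribute [instance] CTMC.countX CTMC.infX CTMC.measΩ CTMC.probμ

variable (M : CTMC)

/-- embedded chain transition probabilities -/
noncomputable def P (x y : M.X) : ℝ := if y = x then 0 else M.Γ x y / M.γ x

/-- jump times -/
noncomputable def J (n : ℕ) (ω : M.Ω) : ℝ := ∑ k ∈ Finset.range n, M.hold k ω

/-- explosion (life) time -/
noncomputable def zeta (ω : M.Ω) : ℝ≥0∞ := ⨆ n, ENNReal.ofReal (M.J n ω)

/-- the continuous-time chain: `pos t ω = some (jump n ω)` if `J n ≤ t < J (n+1)`,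
and `none` (the cemetery state `∂`) after the explosion time. -/
noncomputable def pos (t : ℝ) (ω : M.Ω) : Option M.X :=
  if h : ∃ n, M.J n ω ≤ t ∧ t < M.J (n+1) ω then some (M.jump h.choose ω) else none

/-- passage time: `τ_A = inf {t ≥ 0 : ξ_t ∈ A}` -/
noncomputable def tau (A : Set M.X) (ω : M.Ω) : ℝ≥0∞ :=
  sInf (ENNReal.ofReal '' {s : ℝ | 0 ≤ s ∧ ∃ a ∈ A, M.pos s ω = some a})

/-- `f` belongs to the domain of the generator -/
def InDom (f : M.X → ℝ) : Prop :=
  ∀ x : M.X, Summable (fun y => if y = x then 0 else M.Γ x y * f y)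

/-- `f ∈ Dom_+(Γ)` -/
def InDomPos (f : M.X → ℝ) : Prop := (∀ x, 0 ≤ f x) ∧ M.InDom f

/-- action of the generator : `Γ f (x) = ∑_y Γ_{xy} f(y)` -/
noncomputable def gen (f : M.X → ℝ) (x : M.X) : ℝ :=
  (∑' y, if y = x then 0 else M.Γ x y * f y) - M.γ x * f x

/-- recurrence of the embedded jump chain -/
def JumpRecurrent : Prop := ∀ x : M.X, M.μ x {ω | ∃ n, 1 ≤ n ∧ M.jump n ω = x} = 1

/-- `f → ∞` : all sublevel sets are finite -/
def FinSublevels (f : M.X → ℝ) : Prop := ∀ r : ℝ, {x : M.X | f x ≤ r}.Finite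

end CTMC

namespace CTMC

/-- the natural filtration of the continuous-time chain:
`ℱ t = σ(ξ_s : s ≤ t)` (intersected with the ambient σ-algebra). -/
noncomputable def filt (M : CTMC) : MeasureTheory.Filtration ℝ≥0 M.measΩ where
  seq t := (⨆ s : {s : ℝ≥0 // s ≤ t},
      MeasurableSpace.comap (fun ω => M.pos ((s : ℝ≥0) : ℝ) ω) ⊤) ⊓ M.measΩ
  mono' := by
    intro s t hst
    exact inf_le_inf_right _
      (iSup_le fun u => le_iSup_of_le ⟨u.1, u.2.trans hst⟩ le_rfl)
  le' t := inf_le_right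

end CTMC


namespace CTMC

/-! ### Pathwise facts -/

variable (M : CTMC)

lemma J_zero (ω : M.Ω) : M.J 0 ω = 0 := by simp [J]

lemma J_succ (n : ℕ) (ω : M.Ω) : M.J (n+1) ω = M.J n ω + M.hold n ω := by
  simp [J, Finset.sum_range_succ]

lemma J_strictMono (ω : M.Ω) : StrictMono (fun n => M.J n ω) :=
  strictMono_nat_of_lt_succ fun n => by
    have := M.hold_pos n ω
    simp only [J_succ]; linarith

lemma J_mono (ω : M.Ω) {m n : ℕ} (h : m ≤ n) : M.J m ω ≤ M.J n ω :=
  (M.J_strictMono ω).monotone h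

lemma J_nonneg (n : ℕ) (ω : M.Ω) : 0 ≤ M.J n ω := by
  rw [← M.J_zero ω]; exact M.J_mono ω (Nat.zero_le n)

lemma J_index_unique {ω : M.Ω} {t : ℝ} {m n : ℕ} (h1 : M.J m ω ≤ t) (h2 : t < M.J (m+1) ω)
    (h3 : M.J n ω ≤ t) (h4 : t < M.J (n+1) ω) : m = n := by
  have a1 : m < n + 1 := (M.J_strictMono ω).lt_iff_lt.1 (show M.J m ω < M.J (n+1) ω by linarith)
  have a2 : n < m + 1 := (M.J_strictMono ω).lt_iff_lt.1 (show M.J n ω < M.J (m+1) ω by linarith)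
  omega

lemma pos_eq {ω : M.Ω} {t : ℝ} {n : ℕ} (h1 : M.J n ω ≤ t) (h2 : t < M.J (n+1) ω) :
    M.pos t ω = some (M.jump n ω) := by
  have h : ∃ n, M.J n ω ≤ t ∧ t < M.J (n+1) ω := ⟨n, h1, h2⟩
  unfold pos
  rw [dif_pos h]
  rw [M.J_index_unique h.choose_spec.1 h.choose_spec.2 h1 h2]

lemma pos_eq_some {ω : M.Ω} {t : ℝ} {y : M.X} (h : M.pos t ω = some y) :
    ∃ n, M.J n ω ≤ t ∧ t < M.J (n+1) ω ∧ M.jump n ω = y := by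
  by_cases hh : ∃ n, M.J n ω ≤ t ∧ t < M.J (n+1) ω
  · obtain ⟨n, h1, h2⟩ := hh
    refine ⟨n, h1, h2, ?_⟩
    rw [M.pos_eq h1 h2] at h
    exact Option.some.inj h
  · unfold pos at h
    rw [dif_neg hh] at h
    cases h

lemma exists_index {ω : M.Ω} {t : ℝ} (ht : 0 ≤ t) {n : ℕ} (h : t < M.J n ω) :
    ∃ k, k < n ∧ M.J k ω ≤ t ∧ t < M.J (k+1) ω := by
  induction n with
  | zero => rw [J_zero] at h; linarith
  | succ n ih =>
    by_cases h' : t < M.J n ω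
    · obtain ⟨k, hk, h2⟩ := ih h'
      exact ⟨k, by omega, h2⟩
    · exact ⟨n, by omega, not_lt.1 h', h⟩

lemma pos_none {ω : M.Ω} {t : ℝ} (h : ∀ n, M.J n ω ≤ t) : M.pos t ω = none := by
  unfold pos
  rw [dif_neg]
  rintro ⟨n, _, h2⟩
  exact absurd (h (n+1)) (not_le.2 h2)

lemma pos_right_const (ω : M.Ω) {t : ℝ} (ht : 0 ≤ t) :
    ∃ ε > 0, ∀ u, t ≤ u → u < t + ε → M.pos u ω = M.pos t ω := by
  by_cases h : ∃ n, t < M.J n ω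
  · obtain ⟨n, hn⟩ := h
    obtain ⟨k, _, h1, h2⟩ := M.exists_index ht hn
    refine ⟨M.J (k+1) ω - t, by linarith, fun u hu hu2 => ?_⟩
    rw [M.pos_eq h1 h2, M.pos_eq (h1.trans hu) (by linarith)]
  · push Not at h
    refine ⟨1, one_pos, fun u hu _ => ?_⟩
    rw [M.pos_none h, M.pos_none fun n => (h n).trans hu]

lemma tau_of_hit (A : Set M.X) {ω : M.Ω} {N : ℕ} (h1 : ∀ k, k < N → M.jump k ω ∉ A)
    (h2 : M.jump N ω ∈ A) : M.tau A ω = ENNReal.ofReal (M.J N ω) := by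
  unfold tau
  apply le_antisymm
  · apply sInf_le
    refine ⟨M.J N ω, ⟨M.J_nonneg N ω, M.jump N ω, h2, M.pos_eq le_rfl ?_⟩, rfl⟩
    exact M.J_strictMono ω (Nat.lt_succ_self N)
  · apply le_sInf
    rintro _ ⟨s, ⟨_, a, ha, hs⟩, rfl⟩
    obtain ⟨n, e1, _, e3⟩ := M.pos_eq_some hs
    have : N ≤ n := by
      by_contra hc
      exact h1 n (not_le.1 hc) (e3 ▸ ha)
    exact ENNReal.ofReal_le_ofReal ((M.J_mono ω this).trans e1)

lemma tau_of_not_hit (A : Set M.X) {ω : M.Ω} {n : ℕ} (h1 : ∀ k, k ≤ n → M.jump k ω ∉ A) :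
    ENNReal.ofReal (M.J (n+1) ω) ≤ M.tau A ω := by
  unfold tau
  apply le_sInf
  rintro _ ⟨s, ⟨_, a, ha, hs⟩, rfl⟩
  obtain ⟨m, e1, _, e3⟩ := M.pos_eq_some hs
  have : n + 1 ≤ m := by
    by_contra hc
    exact h1 m (by omega) (e3 ▸ ha)
  exact ENNReal.ofReal_le_ofReal ((M.J_mono ω this).trans e1)

/-- the time `t ∧ τ_A` -/
noncomputable def stopT (A : Set M.X) (t : ℝ≥0) (ω : M.Ω) : ℝ :=
  (((min (t : ℝ≥0∞) (M.tau A ω)).toNNReal : ℝ≥0) : ℝ)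

/-- the function `(f² + b t)^q` -/
noncomputable def hfun (f : M.X → ℝ) (b q : ℝ) (y : M.X) (t : ℝ) : ℝ := (f y ^ 2 + b * t) ^ q

/-- the process -/
noncomputable def Zp (f : M.X → ℝ) (a b q : ℝ) (t : ℝ≥0) (ω : M.Ω) : ℝ :=
  (((M.pos (M.stopT {y | f y ≤ a} t ω) ω).elim 0 f) ^ 2 + b * M.stopT {y | f y ≤ a} t ω) ^ q

lemma stopT_hit (A : Set M.X) {ω : M.Ω} {N : ℕ} (h1 : ∀ k, k < N → M.jump k ω ∉ A)
    (h2 : M.jump N ω ∈ A) {t : ℝ≥0} (ht : M.J N ω ≤ t) : M.stopT A t ω = M.J N ω := by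
  unfold stopT
  rw [M.tau_of_hit A h1 h2, min_eq_right]
  · exact ENNReal.toReal_ofReal (M.J_nonneg N ω)
  · exact (ENNReal.ofReal_le_ofReal ht).trans (by simp)

lemma stopT_not_hit (A : Set M.X) {ω : M.Ω} {n : ℕ} (h1 : ∀ k, k ≤ n → M.jump k ω ∉ A)
    {t : ℝ≥0} (ht : (t : ℝ) ≤ M.J (n+1) ω) : M.stopT A t ω = t := by
  unfold stopT
  rw [min_eq_left]
  · simp
  · refine le_trans ?_ (M.tau_of_not_hit A h1)
    rw [← ENNReal.ofReal_coe_nnreal]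
    exact ENNReal.ofReal_le_ofReal ht

lemma Zp_hit (f : M.X → ℝ) (a b q : ℝ) {ω : M.Ω} {N : ℕ} (h1 : ∀ k, k < N → ¬ f (M.jump k ω) ≤ a)
    (h2 : f (M.jump N ω) ≤ a) {t : ℝ≥0} (ht : M.J N ω ≤ t) :
    M.Zp f a b q t ω = M.hfun f b q (M.jump N ω) (M.J N ω) := by
  unfold Zp hfun
  rw [M.stopT_hit {y | f y ≤ a} h1 h2 ht,
    M.pos_eq le_rfl (M.J_strictMono ω (Nat.lt_succ_self N))]
  rfl

lemma Zp_not_hit (f : M.X → ℝ) (a b q : ℝ) {ω : M.Ω} {n : ℕ}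
    (h1 : ∀ k, k ≤ n → ¬ f (M.jump k ω) ≤ a)
    {t : ℝ≥0} (ht : M.J n ω ≤ t) (ht2 : (t : ℝ) < M.J (n+1) ω) :
    M.Zp f a b q t ω = M.hfun f b q (M.jump n ω) t := by
  unfold Zp hfun
  rw [M.stopT_not_hit {y | f y ≤ a} h1 ht2.le, M.pos_eq ht ht2]
  rfl

lemma stopT_nonneg (A : Set M.X) (t : ℝ≥0) (ω : M.Ω) : 0 ≤ M.stopT A t ω := NNReal.coe_nonneg _

lemma stopT_le (A : Set M.X) (t : ℝ≥0) (ω : M.Ω) : M.stopT A t ω ≤ t := by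
  unfold stopT
  have : (min (t : ℝ≥0∞) (M.tau A ω)).toNNReal ≤ t := by
    have := ENNReal.toNNReal_mono (ENNReal.coe_ne_top (r := t)) (min_le_left (t : ℝ≥0∞) (M.tau A ω))
    simpa using this
  exact_mod_cast this

lemma Zp_nonneg (f : M.X → ℝ) (a b q : ℝ) (hb : 0 ≤ b) (t : ℝ≥0) (ω : M.Ω) :
    0 ≤ M.Zp f a b q t ω := by
  unfold Zp
  have := M.stopT_nonneg {y | f y ≤ a} t ω
  positivity

end CTMC


namespace CTMC
/-! ### Analytic facts -/

lemma rpow_concave_bound {q U V s : ℝ} (hq : 1 ≤ q) (hU : 0 ≤ U) (hV : 0 < V) (hs : 0 ≤ s) :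
    (U + s) ^ q ≤ (V + s) ^ q + (V + s) ^ (q-1) * V ^ (1-q) * (U ^ q - V ^ q) := by
  have hVs : 0 < V + s := by linarith
  have m1 : U / V ∈ Ici (0:ℝ) := by simp only [mem_Ici]; positivity
  have m2 : (1:ℝ) ∈ Ici (0:ℝ) := by simp
  have n1 : 0 ≤ V / (V+s) := by positivity
  have n2 : 0 ≤ s / (V+s) := by positivity
  have n3 : V / (V+s) + s / (V+s) = 1 := by field_simp
  have key := (convexOn_rpow hq).2 m1 m2 n1 n2 n3
  simp only [smul_eq_mul, Real.one_rpow, mul_one] at key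
  have e1 : V / (V + s) * (U / V) + s / (V + s) = (U + s) / (V + s) := by field_simp
  rw [e1, Real.div_rpow (by linarith) hVs.le, Real.div_rpow hU hV.le] at key
  have hq1 : (V + s) ^ q = (V + s) ^ (q-1) * (V + s) := by
    rw [← Real.rpow_add_one hVs.ne']; ring_nf
  have hq2 : V ^ (1 - q) = V / V ^ q := by
    rw [Real.rpow_sub hV, Real.rpow_one]
  have p1 : 0 < (V + s) ^ (q-1) := Real.rpow_pos_of_pos hVs _
  have p2 : 0 < V ^ q := Real.rpow_pos_of_pos hV _
  rw [hq2, hq1]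
  rw [hq1] at key
  rw [div_le_iff₀ (by positivity)] at key
  refine key.trans (le_of_eq ?_)
  field_simp
  ring

variable (M : CTMC)

lemma P_nonneg (x y : M.X) : 0 ≤ M.P x y := by
  unfold P
  split_ifs with h
  · exact le_rfl
  · exact div_nonneg (M.Γ_offdiag_nonneg x y h) (M.γ_pos x).le

lemma P_hasSum (x : M.X) : HasSum (M.P x) 1 := by
  have := (M.γ_sum x).div_const (M.γ x)
  rw [div_self (M.γ_pos x).ne'] at this
  have e : M.P x = fun y => (if y = x then 0 else M.Γ x y) / M.γ x := by
    funext y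
    unfold P
    split_ifs <;> simp
  rw [e]; exact this

lemma P_tsum (x : M.X) : ∑' y, ENNReal.ofReal (M.P x y) = 1 := by
  rw [← ENNReal.ofReal_tsum_of_nonneg (M.P_nonneg x) (M.P_hasSum x).summable,
    (M.P_hasSum x).tsum_eq, ENNReal.ofReal_one]

lemma P_hasSum_gen {g : M.X → ℝ} (hg : M.InDom g) (x : M.X) :
    HasSum (fun y => M.P x y * g y) (g x + M.gen g x / M.γ x) := by
  have := (hg x).hasSum.div_const (M.γ x)
  have h := (M.γ_pos x).ne'
  have e1 : (fun y => M.P x y * g y) = fun y => (if y = x then 0 else M.Γ x y * g y) / M.γ x := by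
    funext y; unfold P
    split_ifs
    · simp
    · ring
  have e2 : g x + M.gen g x / M.γ x = (∑' y, if y = x then 0 else M.Γ x y * g y) / M.γ x := by
    unfold gen
    field_simp
    ring
  rw [e1, e2]; exact this

/-- one step bound for the embedded chain -/
lemma P_hfun_le (f : M.X → ℝ) (p a c : ℝ) (hf0 : ∀ x, 0 ≤ f x) (hp : 2 ≤ p) (ha : 0 < a)
    (hfp : M.InDom fun x => f x ^ p) (hc : 0 < c)
    (hdrift : ∀ x : M.X, a < f x → M.gen (fun y => f y ^ p) x ≤ -c * f x ^ (p - 2))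
    (x : M.X) (hx : a < f x) (b q : ℝ) (hq : q = p / 2) (hb : 0 ≤ b) (t : ℝ) (ht : 0 ≤ t) :
    ∑' y, ENNReal.ofReal (M.P x y) * ENNReal.ofReal ((f y ^ 2 + b * t) ^ q) ≤
      ENNReal.ofReal ((f x ^ 2 + b * t) ^ q - c * (f x ^ 2 + b * t) ^ (q - 1) / M.γ x) := by
  have hfx : 0 < f x := ha.trans hx
  set s := b * t with hs
  have hs0 : 0 ≤ s := by positivity
  set K := (f x ^ 2 + s) ^ (q - 1) * (f x ^ 2) ^ (1 - q) with hK
  have hK0 : 0 ≤ K := by positivity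
  have hsq : ∀ y, (f y ^ 2) ^ q = f y ^ p := fun y => by
    rw [← Real.rpow_natCast_mul (hf0 y), hq]; congr 1; push_cast; ring
  have bound : ∀ y, (f y ^ 2 + s) ^ q ≤ (f x ^ 2 + s) ^ q + K * (f y ^ p - f x ^ p) := fun y => by
    have := rpow_concave_bound (q := q) (U := f y ^ 2) (V := f x ^ 2) (s := s)
      (by rw [hq]; linarith) (by positivity) (by positivity) hs0
    rwa [hsq, hsq] at this
  have hsum : HasSum (fun y => M.P x y * ((f x ^ 2 + s) ^ q + K * (f y ^ p - f x ^ p)))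
      ((f x ^ 2 + s) ^ q + K * (M.gen (fun y => f y ^ p) x / M.γ x)) := by
    have h1 := (M.P_hasSum_gen hfp x).mul_left K
    have h2 := (M.P_hasSum x).mul_right ((f x ^ 2 + s) ^ q - K * f x ^ p)
    have h3 := h2.add h1
    have e1 : (fun y => M.P x y * ((f x ^ 2 + s) ^ q + K * (f y ^ p - f x ^ p))) =
        fun y => M.P x y * ((f x ^ 2 + s) ^ q - K * f x ^ p) + K * (M.P x y * f y ^ p) := by
      funext y; ring
    have e2 : (f x ^ 2 + s) ^ q + K * (M.gen (fun y => f y ^ p) x / M.γ x) =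
        1 * ((f x ^ 2 + s) ^ q - K * f x ^ p) +
          K * (f x ^ p + M.gen (fun y => f y ^ p) x / M.γ x) := by ring
    rw [e1, e2]; exact h3
  calc ∑' y, ENNReal.ofReal (M.P x y) * ENNReal.ofReal ((f y ^ 2 + s) ^ q)
      ≤ ∑' y, ENNReal.ofReal (M.P x y * ((f x ^ 2 + s) ^ q + K * (f y ^ p - f x ^ p))) := by
        refine ENNReal.tsum_le_tsum fun y => ?_
        rw [← ENNReal.ofReal_mul (M.P_nonneg x y)]
        exact ENNReal.ofReal_le_ofReal (mul_le_mul_of_nonneg_left (bound y) (M.P_nonneg x y))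
    _ = ENNReal.ofReal ((f x ^ 2 + s) ^ q + K * (M.gen (fun y => f y ^ p) x / M.γ x)) := by
        rw [← ENNReal.ofReal_tsum_of_nonneg _ hsum.summable, hsum.tsum_eq]
        intro y
        refine mul_nonneg (M.P_nonneg x y) (le_trans ?_ (bound y))
        positivity
    _ ≤ _ := by
        apply ENNReal.ofReal_le_ofReal
        have h3 : K * (M.gen (fun y => f y ^ p) x / M.γ x) ≤
            K * (-c * f x ^ (p - 2) / M.γ x) := by
          gcongr
          · exact (M.γ_pos x).le
          · exact hdrift x hx
        have h4 : (f x ^ 2) ^ (1 - q) * f x ^ (p - 2) = 1 := by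
          rw [← Real.rpow_natCast_mul hfx.le, ← Real.rpow_add hfx, hq]
          have : ((2:ℕ):ℝ) * (1 - p/2) + (p - 2) = 0 := by push_cast; ring
          rw [this, Real.rpow_zero]
        have h5 : K * (-c * f x ^ (p - 2) / M.γ x) =
            - (c * (f x ^ 2 + s) ^ (q - 1) / M.γ x) := by
          rw [hK]
          calc _ = - (c * (f x ^ 2 + s) ^ (q - 1) / M.γ x) *
                ((f x ^ 2) ^ (1 - q) * f x ^ (p - 2)) := by ring
            _ = _ := by rw [h4, mul_one]
        linarith

lemma expMeasure_Ioi {r v : ℝ} (hr : 0 < r) (hv : 0 ≤ v) :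
    ProbabilityTheory.expMeasure r (Ioi v) = ENNReal.ofReal (Real.exp (-r * v)) := by
  have := ProbabilityTheory.isProbabilityMeasure_expMeasure hr
  have h1 := ProbabilityTheory.cdf_expMeasure_eq hr v
  rw [if_pos hv] at h1
  rw [← compl_Iic, prob_compl_eq_one_sub measurableSet_Iic]
  rw [← ProbabilityTheory.ofReal_cdf, h1, ← ENNReal.ofReal_one, ← ENNReal.ofReal_sub]
  · congr 1; ring_nf
  · have : Real.exp (-(r * v)) ≤ 1 := Real.exp_le_one_iff.2 (by nlinarith)
    linarith

lemma setLIntegral_expMeasure {r : ℝ} {S : Set ℝ} (hS : MeasurableSet S) (hS0 : S ⊆ Ici 0)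
    {g : ℝ → ℝ≥0∞} (hg : Measurable g) :
    ∫⁻ u in S, g u ∂(ProbabilityTheory.expMeasure r) =
      ∫⁻ u in S, ENNReal.ofReal (r * Real.exp (-(r * u))) * g u := by
  have : ProbabilityTheory.expMeasure r =
      volume.withDensity (ProbabilityTheory.exponentialPDF r) := rfl
  rw [this, restrict_withDensity hS, lintegral_withDensity_eq_lintegral_mul _ _ hg]
  · refine setLIntegral_congr_fun hS fun u hu => ?_
    simp only [Pi.mul_apply]
    rw [ProbabilityTheory.exponentialPDF_of_nonneg (hS0 hu)]
  · exact (ProbabilityTheory.measurable_exponentialPDFReal r).ennreal_ofReal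

/-- one step inequality in time: `w` current time, `r` time of last jump, `T` horizon -/
lemma one_step (f : M.X → ℝ) (p a c : ℝ) (hf0 : ∀ x, 0 ≤ f x) (hp : 2 ≤ p) (ha : 0 < a)
    (hfp : M.InDom fun x => f x ^ p) (hc : 0 < c)
    (hdrift : ∀ x : M.X, a < f x → M.gen (fun y => f y ^ p) x ≤ -c * f x ^ (p - 2))
    (x : M.X) (hx : a < f x) (b q : ℝ) (hq : q = p / 2) (hb : b = 2 * c / p)
    (r w T : ℝ) (hr : 0 ≤ r) (hrw : r ≤ w) (hwT : w ≤ T) :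
    ∑' y, ENNReal.ofReal (M.P x y) *
      ∫⁻ u in Ioi (w - r), (if T < r + u then ENNReal.ofReal ((f x ^ 2 + b * T) ^ q)
        else ENNReal.ofReal ((f y ^ 2 + b * (r + u)) ^ q)) ∂(ProbabilityTheory.expMeasure (M.γ x))
      ≤ ENNReal.ofReal (Real.exp (-M.γ x * (w - r))) * ENNReal.ofReal ((f x ^ 2 + b * w) ^ q) := by
  set g := M.γ x with hg
  have hg0 : 0 < g := M.γ_pos x
  have hb0 : 0 < b := by rw [hb]; positivity
  have hq1 : 1 ≤ q := by rw [hq]; linarith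
  have hbq : q * b = c := by rw [hq, hb]; field_simp
  set H : ℝ → ℝ := fun t => (f x ^ 2 + b * t) ^ q with hH
  set H' : ℝ → ℝ := fun t => c * (f x ^ 2 + b * t) ^ (q - 1) with hH'
  have hbound : ∀ t, 0 ≤ t →
      ∑' y, ENNReal.ofReal (M.P x y) * ENNReal.ofReal ((f y ^ 2 + b * t) ^ q) ≤
      ENNReal.ofReal (H t - H' t / g) := fun t ht =>
    M.P_hfun_le f p a c hf0 hp ha hfp hc hdrift x hx b q hq hb0.le t ht
  have hderH : ∀ t, HasDerivAt H (H' t) t := fun t => by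
    have h1 : HasDerivAt (fun t => f x ^ 2 + b * t) b t := by
      simpa using ((hasDerivAt_id t).const_mul b).const_add (f x ^ 2)
    have h2 := h1.rpow_const (p := q) (Or.inr hq1)
    convert h2 using 1
    simp only [hH']; rw [← hbq]; ring
  have hmeas : ∀ y, Measurable (fun u : ℝ => if T < r + u then ENNReal.ofReal ((f x ^ 2 + b * T) ^ q)
        else ENNReal.ofReal ((f y ^ 2 + b * (r + u)) ^ q)) := fun y => by
    refine Measurable.ite (measurableSet_lt measurable_const (by fun_prop)) measurable_const ?_
    exact ENNReal.measurable_ofReal.comp (by fun_prop)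
  have hsplit : Ioi (w - r) = Ioc (w - r) (T - r) ∪ Ioi (T - r) :=
    (Ioc_union_Ioi_eq_Ioi (by linarith)).symm
  have hcont : Continuous fun u => g * Real.exp (-(g * u)) * (H (r+u) - H' (r+u) / g) := by
    have c1 : Continuous H := continuous_iff_continuousAt.2 fun t => (hderH t).continuousAt
    have c2 : Continuous H' := by
      simp only [hH']
      exact continuous_const.mul
        (Continuous.rpow_const (by fun_prop) fun t => Or.inr (by linarith))
    fun_prop
  have hnn : ∀ u ∈ Ioc (w-r) (T-r), 0 ≤ g * Real.exp (-(g * u)) * (H (r+u) - H' (r+u) / g) := by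
    intro u hu
    refine mul_nonneg (by positivity) ?_
    have hu0 : 0 ≤ r + u := by have := hu.1; linarith
    have hfx : 0 < f x := ha.trans hx
    by_contra hneg
    have h1 := hbound (r+u) hu0
    rw [ENNReal.ofReal_of_nonpos (not_le.1 hneg).le] at h1
    have h2 : ∑' y, ENNReal.ofReal (M.P x y) * ENNReal.ofReal ((f y ^ 2 + b * (r+u)) ^ q) = 0 :=
      le_antisymm h1 bot_le
    rw [ENNReal.tsum_eq_zero] at h2
    have hpos : 0 < r + u ∨ r + u = 0 := by
      rcases hu0.lt_or_eq with h | h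
      · exact Or.inl h
      · exact Or.inr h.symm
    rcases hpos with hpos | hz
    · have h3 : ∑' y, ENNReal.ofReal (M.P x y) = 0 := by
        rw [ENNReal.tsum_eq_zero]
        intro y
        have := h2 y
        rw [mul_eq_zero] at this
        rcases this with h | h
        · exact h
        · exfalso
          rw [ENNReal.ofReal_eq_zero] at h
          have : 0 < (f y ^ 2 + b * (r+u)) ^ q := by positivity
          linarith
      rw [M.P_tsum] at h3
      exact one_ne_zero h3
    · have := hu.1
      linarith
  have hI : ∫ u in Ioc (w-r) (T-r), g * Real.exp (-(g * u)) * (H (r+u) - H' (r+u) / g) =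
      Real.exp (-g * (w - r)) * H w - Real.exp (-g * (T - r)) * H T := by
    rw [← intervalIntegral.integral_of_le (by linarith)]
    have := intervalIntegral.integral_eq_sub_of_hasDerivAt (a := w - r) (b := T - r)
      (f := fun u => - (Real.exp (-g * u) * H (r + u)))
      (f' := fun u => g * Real.exp (-(g * u)) * (H (r+u) - H' (r+u) / g)) ?_
      (hcont.intervalIntegrable _ _)
    · rw [this]
      simp only [add_sub_cancel]
      ring
    · intro u _
      have d1 : HasDerivAt (fun u => Real.exp (-g * u)) (Real.exp (-g * u) * (-g)) u := by
        have := ((hasDerivAt_id u).const_mul (-g)).exp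
        simpa using this
      have d2 : HasDerivAt (fun u => H (r + u)) (H' (r+u)) u := by
        simpa using (hderH (r+u)).comp_const_add r u
      refine ((d1.fun_mul d2).fun_neg).congr_deriv ?_
      have : -(g*u) = -g*u := by ring
      rw [this]
      field_simp
      ring
  have hI0 : 0 ≤ Real.exp (-g * (w - r)) * H w - Real.exp (-g * (T - r)) * H T := by
    rw [← hI]; exact setIntegral_nonneg measurableSet_Ioc hnn
  calc _ = ∫⁻ u in Ioi (w - r), ∑' y, ENNReal.ofReal (M.P x y) *
        (if T < r + u then ENNReal.ofReal (H T)
        else ENNReal.ofReal ((f y ^ 2 + b * (r + u)) ^ q)) ∂(ProbabilityTheory.expMeasure g) := by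
        rw [lintegral_tsum fun y => ((hmeas y).const_mul _).aemeasurable]
        refine tsum_congr fun y => ?_
        rw [lintegral_const_mul _ (hmeas y)]
    _ = (∫⁻ u in Ioc (w - r) (T - r), ∑' y, ENNReal.ofReal (M.P x y) *
          ENNReal.ofReal ((f y ^ 2 + b * (r + u)) ^ q) ∂(ProbabilityTheory.expMeasure g))
        + ∫⁻ u in Ioi (T - r), ENNReal.ofReal (H T) ∂(ProbabilityTheory.expMeasure g) := by
        rw [hsplit, lintegral_union measurableSet_Ioi (Ioc_disjoint_Ioi le_rfl)]
        congr 1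
        · refine setLIntegral_congr_fun measurableSet_Ioc fun u hu => ?_
          refine tsum_congr fun y => ?_
          rw [if_neg (by have := hu.2; simp only [not_lt]; linarith)]
        · refine setLIntegral_congr_fun measurableSet_Ioi fun u hu => ?_
          have hu' : T < r + u := by have : T - r < u := hu; linarith
          simp only [if_pos hu']
          rw [ENNReal.tsum_mul_right, M.P_tsum, one_mul]
    _ ≤ (∫⁻ u in Ioc (w - r) (T - r), ENNReal.ofReal (H (r+u) - H' (r+u) / g)
          ∂(ProbabilityTheory.expMeasure g))
        + ENNReal.ofReal (H T) * ENNReal.ofReal (Real.exp (-g * (T - r))) := by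
        rw [setLIntegral_const, expMeasure_Ioi hg0 (by linarith)]
        gcongr ?_ + _
        refine setLIntegral_mono' measurableSet_Ioc fun u hu => ?_
        exact hbound _ (by have := hu.1; linarith)
    _ = (∫⁻ u in Ioc (w - r) (T - r), ENNReal.ofReal (g * Real.exp (-(g * u)) *
            (H (r+u) - H' (r+u) / g)))
        + ENNReal.ofReal (H T) * ENNReal.ofReal (Real.exp (-g * (T - r))) := by
        rw [setLIntegral_expMeasure measurableSet_Ioc]
        · congr 1
          refine lintegral_congr fun u => ?_
          rw [← ENNReal.ofReal_mul (by positivity)]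
        · intro u hu; have := hu.1; simp only [mem_Ici]; linarith
        · exact ENNReal.measurable_ofReal.comp (by simp only [hH, hH']; fun_prop)
    _ = ENNReal.ofReal (Real.exp (-g * (w - r)) * H w - Real.exp (-g * (T - r)) * H T)
        + ENNReal.ofReal (H T) * ENNReal.ofReal (Real.exp (-g * (T - r))) := by
        congr 1
        rw [← ofReal_integral_eq_lintegral_ofReal, hI]
        · exact (hcont.integrableOn_Icc).mono_set Ioc_subset_Icc_self
        · exact (ae_restrict_iff' measurableSet_Ioc).2 (Eventually.of_forall hnn)
    _ = _ := by
        have hHT : 0 ≤ H T := by simp only [hH]; have : 0 ≤ T := by linarith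
                                 positivity
        rw [← ENNReal.ofReal_mul hHT, ← ENNReal.ofReal_add hI0 (by positivity),
          ← ENNReal.ofReal_mul (by positivity)]
        congr 1
        simp only [hH]
        ring
end CTMC


namespace CTMC
/-! ### The Markov property at jump times -/
variable (M : CTMC)

/-- cylinder sets -/
def cyl (n : ℕ) (path : ℕ → M.X) (t : ℕ → ℝ) : Set M.Ω :=
  {ω | (∀ k, k ≤ n → M.jump k ω = path k) ∧ (∀ k, k < n → t k < M.hold k ω)}

/-- the class of cylinder sets up to the `n`-th jump -/
def cyls (n : ℕ) : Set (Set M.Ω) :=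
  {S | ∃ (path : ℕ → M.X) (t : ℕ → ℝ), (∀ k, 0 ≤ t k) ∧ S = M.cyl n path t}

/-- history up to the `n`-th jump -/
@[reducible] def G (n : ℕ) : MeasurableSpace M.Ω := MeasurableSpace.generateFrom (M.cyls n)

lemma cyls_pi (n : ℕ) : IsPiSystem (M.cyls n) := by
  rintro _ ⟨p1, t1, h1, rfl⟩ _ ⟨p2, t2, h2, rfl⟩ ⟨ω0, ⟨a1, _⟩, ⟨a2, _⟩⟩
  refine ⟨p1, fun k => max (t1 k) (t2 k), fun k => le_max_of_le_left (h1 k), ?_⟩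
  ext ω
  constructor
  · rintro ⟨⟨b1, b2⟩, ⟨b3, b4⟩⟩
    exact ⟨b1, fun k hk => max_lt (b2 k hk) (b4 k hk)⟩
  · rintro ⟨b1, b2⟩
    refine ⟨⟨b1, fun k hk => (le_max_left _ _).trans_lt (b2 k hk)⟩,
      ⟨fun k hk => ?_, fun k hk => (le_max_right _ _).trans_lt (b2 k hk)⟩⟩
    rw [b1 k hk, ← a1 k hk, a2 k hk]

lemma measurableSet_cyl (n : ℕ) (path : ℕ → M.X) (t : ℕ → ℝ) : MeasurableSet (M.cyl n path t) := by
  have : M.cyl n path t = (⋂ k ∈ {k | k ≤ n}, {ω | M.jump k ω = path k}) ∩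
      ⋂ k ∈ {k | k < n}, {ω | t k < M.hold k ω} := by
    ext ω; simp [cyl]
  rw [this]
  refine MeasurableSet.inter ?_ ?_
  · exact MeasurableSet.biInter (to_countable _) fun k _ => M.jump_meas k _
  · exact MeasurableSet.biInter (to_countable _) fun k _ =>
      measurableSet_lt measurable_const (M.hold_meas k)

lemma G_le (n : ℕ) : M.G n ≤ M.measΩ := by
  apply MeasurableSpace.generateFrom_le
  rintro _ ⟨p, t, _, rfl⟩
  exact M.measurableSet_cyl n p t

/-- extension of a finite path -/
noncomputable def extp (n : ℕ) (qq : Fin (n+1) → M.X) (k : ℕ) : M.X :=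
  if h : k < n + 1 then qq ⟨k, h⟩ else qq 0

lemma eq_iUnion_cyl (n : ℕ) (t : ℕ → ℝ) :
    {ω | ∀ k, k < n → t k < M.hold k ω} = ⋃ qq : Fin (n+1) → M.X, M.cyl n (M.extp n qq) t := by
  ext ω
  simp only [mem_iUnion, mem_ofPred_eq, cyl]
  constructor
  · intro h
    refine ⟨fun i => M.jump i ω, fun k hk => ?_, h⟩
    simp only [extp]
    rw [dif_pos (by omega)]
  · rintro ⟨_, _, h⟩; exact h

lemma cyl_disjoint (n : ℕ) (t : ℕ → ℝ) :
    Pairwise (Function.onFun Disjoint fun qq : Fin (n+1) → M.X => M.cyl n (M.extp n qq) t) := by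
  intro q1 q2 hne
  rw [Function.onFun, Set.disjoint_left]
  rintro ω ⟨h1, _⟩ ⟨h2, _⟩
  apply hne
  funext i
  have a1 := h1 i (by omega)
  have a2 := h2 i (by omega)
  simp only [extp] at a1 a2
  rw [dif_pos i.2] at a1 a2
  exact a1.symm.trans a2

lemma univ_eq_iUnion_cyl (n : ℕ) :
    (univ : Set M.Ω) = ⋃ qq : Fin (n+1) → M.X, M.cyl n (M.extp n qq) (fun _ => 0) := by
  rw [← eq_iUnion_cyl]
  ext ω
  simp [M.hold_pos]

lemma cyl_mem_G (n : ℕ) (path : ℕ → M.X) {t : ℕ → ℝ} (ht : ∀ k, 0 ≤ t k) :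
    MeasurableSet[M.G n] (M.cyl n path t) :=
  MeasurableSpace.measurableSet_generateFrom ⟨path, t, ht, rfl⟩

lemma jump_G {n k : ℕ} (hk : k ≤ n) (D : Set M.X) : MeasurableSet[M.G n] {ω | M.jump k ω ∈ D} := by
  have : {ω | M.jump k ω ∈ D} = ⋃ qq ∈ {qq : Fin (n+1) → M.X | qq ⟨k, by omega⟩ ∈ D},
      M.cyl n (M.extp n qq) (fun _ => 0) := by
    ext ω
    simp only [mem_iUnion, mem_ofPred_eq, cyl, exists_prop]
    constructor
    · intro h
      refine ⟨fun i => M.jump i ω, h, fun k hk => ?_, fun k _ => M.hold_pos k ω⟩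
      simp only [extp]
      rw [dif_pos (by omega)]
    · rintro ⟨qq, h1, h2, _⟩
      rw [h2 k hk]
      simp only [extp]
      rwa [dif_pos (by omega)]
  rw [this]
  exact MeasurableSet.biUnion (to_countable _) fun qq _ => M.cyl_mem_G n _ fun _ => le_rfl

lemma hold_G {n k : ℕ} (hk : k < n) : Measurable[M.G n] (M.hold k) := by
  refine @measurable_of_Ioi _ _ _ _ _ (M.G n) _ _ _ _ fun v => ?_
  by_cases hv : 0 ≤ v
  · have : M.hold k ⁻¹' Ioi v = ⋃ qq : Fin (n+1) → M.X,
        M.cyl n (M.extp n qq) (fun j => if j = k then v else 0) := by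
      rw [← eq_iUnion_cyl]
      ext ω
      simp only [mem_preimage, mem_Ioi, mem_ofPred_eq]
      constructor
      · intro h j _
        split_ifs with hj
        · rwa [hj]
        · exact M.hold_pos j ω
      · intro h
        simpa using h k hk
    rw [this]
    exact MeasurableSet.iUnion fun qq => M.cyl_mem_G n _ fun j => by split_ifs <;> simp [hv]
  · have : M.hold k ⁻¹' Ioi v = univ := by
      ext ω; simp only [mem_preimage, mem_Ioi, mem_univ, iff_true]
      exact (not_le.1 hv).trans (M.hold_pos k ω)
    rw [this]; exact MeasurableSet.univ

lemma J_G {n k : ℕ} (hk : k ≤ n) : Measurable[M.G n] (M.J k) := by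
  have : M.J k = fun ω => ∑ i ∈ Finset.range k, M.hold i ω := rfl
  rw [this]
  exact Finset.measurable_fun_sum _ fun i hi => M.hold_G (by
    have := Finset.mem_range.1 hi; omega)

lemma J_meas (n : ℕ) : Measurable (M.J n) := (M.J_G le_rfl).mono (M.G_le n) le_rfl

lemma G_mono {m n : ℕ} (h : m ≤ n) : M.G m ≤ M.G n := by
  apply MeasurableSpace.generateFrom_le
  rintro _ ⟨p, t, _, rfl⟩
  have : M.cyl m p t = (⋂ k ∈ {k | k ≤ m}, {ω | M.jump k ω ∈ ({p k} : Set M.X)}) ∩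
      ⋂ k ∈ {k | k < m}, M.hold k ⁻¹' Ioi (t k) := by
    ext ω; simp [cyl]
  rw [this]
  refine MeasurableSet.inter ?_ ?_
  · exact MeasurableSet.biInter (to_countable _) fun k hk => M.jump_G (le_trans hk h) _
  · exact MeasurableSet.biInter (to_countable _) fun k hk =>
      M.hold_G (lt_of_lt_of_le hk h) measurableSet_Ioi

lemma jump_meas' (n : ℕ) (D : Set M.X) : MeasurableSet {ω | M.jump n ω ∈ D} :=
  M.G_le n _ (M.jump_G le_rfl D)

lemma start_ne (x : M.X) {z : M.X} (hz : z ≠ x) : M.μ x {ω | M.jump 0 ω = z} = 0 := by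
  have h1 := M.start x
  rw [← prob_compl_eq_zero_iff (M.jump_meas 0 x)] at h1
  refine measure_mono_null ?_ h1
  intro ω hω
  simp only [mem_ofPred_eq] at hω
  simp [hω, hz]

lemma markov_cyl (x0 : M.X) (n : ℕ) (x y : M.X) {v : ℝ} (hv : 0 ≤ v) (path : ℕ → M.X) {t : ℕ → ℝ}
    (ht : ∀ k, 0 ≤ t k) :
    M.μ x0 (M.cyl n path t ∩ ({ω | M.jump n ω = x} ∩ {ω | M.jump (n+1) ω = y} ∩
      {ω | v < M.hold n ω})) =
    ENNReal.ofReal (M.P x y * Real.exp (-M.γ x * v)) *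
      M.μ x0 (M.cyl n path t ∩ {ω | M.jump n ω = x}) := by
  by_cases h0 : path 0 = x0
  swap
  · have : M.μ x0 (M.cyl n path t) = 0 :=
      measure_mono_null (fun ω hω => hω.1 0 (Nat.zero_le _)) (M.start_ne x0 h0)
    rw [measure_mono_null inter_subset_left this, measure_mono_null inter_subset_left this, mul_zero]
  by_cases hx : path n = x
  swap
  · have e : M.cyl n path t ∩ {ω | M.jump n ω = x} = ∅ := by
      rw [Set.eq_empty_iff_forall_notMem]
      rintro ω ⟨h1, h2⟩
      exact hx ((h1.1 n le_rfl).symm.trans h2)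
    rw [← inter_assoc, ← inter_assoc, e]
    simp
  have e1 : M.cyl n path t ∩ {ω | M.jump n ω = x} = M.cyl n path t := by
    rw [inter_eq_left]
    intro ω h1
    exact (h1.1 n le_rfl).trans hx
  set path' : ℕ → M.X := fun k => if k ≤ n then path k else y with hpath
  set t' : ℕ → ℝ := fun k => if k < n then t k else v with ht'
  have e2 : M.cyl n path t ∩ ({ω | M.jump n ω = x} ∩ {ω | M.jump (n+1) ω = y} ∩
      {ω | v < M.hold n ω}) = M.cyl (n+1) path' t' := by
    ext ω
    constructor
    · rintro ⟨⟨h1, h2⟩, ⟨_, h4⟩, h5⟩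
      refine ⟨fun k hk => ?_, fun k hk => ?_⟩
      · simp only [hpath]
        split_ifs with hkn
        · exact h1 k hkn
        · have : k = n + 1 := by omega
          rw [this]; exact h4
      · simp only [ht']
        split_ifs with hkn
        · exact h2 k hkn
        · have : k = n := by omega
          rw [this]; exact h5
    · rintro ⟨h1, h2⟩
      have a1 : ∀ k, k ≤ n → M.jump k ω = path k := fun k hk => by
        have := h1 k (by omega)
        simp only [hpath] at this
        rwa [if_pos hk] at this
      refine ⟨⟨a1, fun k hk => ?_⟩, ⟨?_, ?_⟩, ?_⟩
      · have := h2 k (by omega)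
        simp only [ht'] at this
        rwa [if_pos hk] at this
      · exact (a1 n le_rfl).trans hx
      · have := h1 (n+1) le_rfl
        simp only [hpath] at this
        rwa [if_neg (by omega)] at this
      · have := h2 n (by omega)
        simp only [ht'] at this
        rwa [if_neg (by omega)] at this
  rw [e1, e2]
  unfold cyl
  rw [M.law x0 n path t h0 ht, M.law x0 (n+1) path' t' (by simp [hpath, h0])
    (fun k => by simp only [ht']; split_ifs; exacts [ht k, hv]), Finset.prod_range_succ]
  have e3 : ∏ k ∈ Finset.range n,
          ((if path' (k+1) = path' k then 0 else M.Γ (path' k) (path' (k+1)) / M.γ (path' k))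
            * Real.exp (-(M.γ (path' k)) * t' k)) = ∏ k ∈ Finset.range n,
          ((if path (k+1) = path k then 0 else M.Γ (path k) (path (k+1)) / M.γ (path k))
            * Real.exp (-(M.γ (path k)) * t k)) := by
    refine Finset.prod_congr rfl fun k hk => ?_
    have hk := Finset.mem_range.1 hk
    have a1 : path' (k+1) = path (k+1) := if_pos (by omega)
    have a2 : path' k = path k := if_pos (by omega)
    have a3 : t' k = t k := if_pos hk
    rw [a1, a2, a3]
  have a1 : path' (n+1) = y := if_neg (by omega)
  have a2 : path' n = x := (if_pos le_rfl).trans hx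
  have a3 : t' n = v := if_neg (by omega)
  rw [e3, a1, a2, a3, mul_comm, ENNReal.ofReal_mul]
  · rfl
  · exact mul_nonneg (M.P_nonneg x y) (Real.exp_pos _).le

lemma markov_set (x0 : M.X) (n : ℕ) (x y : M.X) {v : ℝ} (hv : 0 ≤ v) {E : Set M.Ω}
    (hE : MeasurableSet[M.G n] E) :
    M.μ x0 (E ∩ ({ω | M.jump n ω = x} ∩ {ω | M.jump (n+1) ω = y} ∩ {ω | v < M.hold n ω})) =
    ENNReal.ofReal (M.P x y * Real.exp (-M.γ x * v)) * M.μ x0 (E ∩ {ω | M.jump n ω = x}) := by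
  set S := ({ω | M.jump n ω = x} ∩ {ω | M.jump (n+1) ω = y} ∩ {ω | v < M.hold n ω}) with hS
  set cc := ENNReal.ofReal (M.P x y * Real.exp (-M.γ x * v)) with hcc
  have hSm : MeasurableSet S := ((M.jump_meas n x).inter (M.jump_meas _ y)).inter
    (measurableSet_lt measurable_const (M.hold_meas n))
  have h1 : ∀ s ∈ M.cyls n, (M.μ x0).restrict S s =
      (cc • (M.μ x0).restrict {ω | M.jump n ω = x}) s := by
    rintro _ ⟨p, t, ht, rfl⟩
    rw [Measure.smul_apply, Measure.restrict_apply' hSm, Measure.restrict_apply' (M.jump_meas n x),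
      smul_eq_mul]
    exact M.markov_cyl x0 n x y hv p ht
  have h2 : (M.μ x0).restrict S univ = (cc • (M.μ x0).restrict {ω | M.jump n ω = x}) univ := by
    rw [M.univ_eq_iUnion_cyl n]
    rw [measure_iUnion (M.cyl_disjoint n _) fun i => M.measurableSet_cyl _ _ _,
      measure_iUnion (M.cyl_disjoint n _) fun i => M.measurableSet_cyl _ _ _]
    exact tsum_congr fun i => h1 _ ⟨_, _, fun _ => le_rfl, rfl⟩
  have := ext_on_measurableSpace_of_generate_finite M.measΩ (M.cyls n) h1 (M.G_le n) rfl
    (M.cyls_pi n) h2 hE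
  rw [Measure.smul_apply, Measure.restrict_apply' hSm, Measure.restrict_apply' (M.jump_meas n x),
      smul_eq_mul] at this
  exact this

open ProbabilityTheory in
lemma markov_lintegral (x0 : M.X) (n : ℕ) (x y : M.X) {E : Set M.Ω}
    (hE : MeasurableSet[M.G n] E) {g : ℝ × ℝ → ℝ≥0∞} (hg : Measurable g) :
    ∫⁻ ω in E ∩ ({ω | M.jump n ω = x} ∩ {ω | M.jump (n+1) ω = y}),
      g (M.J n ω, M.hold n ω) ∂(M.μ x0) =
    ENNReal.ofReal (M.P x y) * ∫⁻ ω in E ∩ {ω | M.jump n ω = x},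
      ∫⁻ u, g (M.J n ω, u) ∂(expMeasure (M.γ x)) ∂(M.μ x0) := by
  have hpr := isProbabilityMeasure_expMeasure (M.γ_pos x)
  have hJh : Measurable fun ω => (M.J n ω, M.hold n ω) := (M.J_meas n).prodMk (M.hold_meas n)
  have hEm := M.G_le n _ hE
  set ν1 : Measure ℝ := ENNReal.ofReal (M.P x y) •
    ((M.μ x0).restrict (E ∩ {ω | M.jump n ω = x})).map (M.J n) with hν1
  have hfin : IsFiniteMeasure ν1 := by
    constructor
    rw [hν1, Measure.smul_apply, smul_eq_mul]
    exact ENNReal.mul_lt_top ENNReal.ofReal_lt_top (measure_lt_top _ _)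
  have key : ν1.prod (expMeasure (M.γ x)) =
      ((M.μ x0).restrict (E ∩ ({ω | M.jump n ω = x} ∩ {ω | M.jump (n+1) ω = y}))).map
        (fun ω => (M.J n ω, M.hold n ω)) := by
    have hsp : (expMeasure (M.γ x)).FiniteSpanningSetsIn (range Ioi) :=
      { set := fun k => Ioi (-(k:ℝ))
        set_mem := fun k => ⟨_, rfl⟩
        finite := fun k => measure_lt_top _ _
        spanning := by
          rw [eq_univ_iff_forall]
          intro z
          obtain ⟨k, hk⟩ := exists_nat_gt (-z)
          exact mem_iUnion.2 ⟨k, by simp only [mem_Ioi]; linarith⟩ }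
    refine Measure.prod_eq_generateFrom (C := {s | MeasurableSet s}) (D := range Ioi)
      MeasurableSpace.generateFrom_measurableSet ?_ MeasurableSpace.isPiSystem_measurableSet
      isPiSystem_Ioi ν1.toFiniteSpanningSetsIn hsp ?_
    · rw [← borel_eq_generateFrom_Ioi]; exact (BorelSpace.measurable_eq).symm
    · rintro s hs _ ⟨v, rfl⟩
      have hs : MeasurableSet s := hs
      rw [Measure.map_apply hJh (hs.prod measurableSet_Ioi), hν1, Measure.smul_apply,
        Measure.map_apply (M.J_meas n) hs, smul_eq_mul, Measure.restrict_apply (M.J_meas n hs),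
        Measure.restrict_apply (hJh (hs.prod measurableSet_Ioi))]
      have hE2 : MeasurableSet[M.G n] (M.J n ⁻¹' s ∩ E) := (M.J_G le_rfl hs).inter hE
      have e0 : expMeasure (M.γ x) (Ioi v) =
          ENNReal.ofReal (Real.exp (-M.γ x * (max v 0))) := by
        rcases le_total 0 v with h | h
        · rw [expMeasure_Ioi (M.γ_pos x) h, max_eq_left h]
        · rw [max_eq_right h]
          apply le_antisymm
          · simpa using prob_le_one
          · rw [← expMeasure_Ioi (M.γ_pos x) le_rfl]
            exact measure_mono (Ioi_subset_Ioi h)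
      have := M.markov_set x0 n x y (le_max_right v 0) hE2
      rw [e0]
      have e3 : (fun ω => (M.J n ω, M.hold n ω)) ⁻¹' s ×ˢ Ioi v ∩
          (E ∩ ({ω | M.jump n ω = x} ∩ {ω | M.jump (n+1) ω = y})) =
          M.J n ⁻¹' s ∩ E ∩ ({ω | M.jump n ω = x} ∩ {ω | M.jump (n+1) ω = y} ∩
          {ω | max v 0 < M.hold n ω}) := by
        ext ω
        have := M.hold_pos n ω
        simp only [mem_inter_iff, mem_preimage, mem_prod, mem_Ioi, mem_ofPred_eq, max_lt_iff]
        tauto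
      rw [e3, this, ENNReal.ofReal_mul (M.P_nonneg x y), inter_assoc]
      ring
  rw [← lintegral_map hg hJh, ← key, lintegral_prod _ hg.aemeasurable, hν1, lintegral_smul_measure,
    lintegral_map _ (M.J_meas n), smul_eq_mul]
  exact hg.lintegral_prod_right'

end CTMC


namespace CTMC
/-! ### Natural filtration -/
variable (M : CTMC)

/-- the natural filtration before intersecting with the ambient sigma-algebra -/
@[reducible] noncomputable def nat0 (t : ℝ≥0) : MeasurableSpace M.Ω :=
  ⨆ s : {s : ℝ≥0 // s ≤ t}, MeasurableSpace.comap (fun ω => M.pos ((s : ℝ≥0) : ℝ) ω) ⊤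

lemma filt_eq (t : ℝ≥0) : (M.filt t : MeasurableSpace M.Ω) = M.nat0 t ⊓ M.measΩ := rfl

lemma pos_meas (t : ℝ) (D : Set (Option M.X)) : MeasurableSet {ω | M.pos t ω ∈ D} := by
  have h1 : ∀ y, MeasurableSet {ω | M.pos t ω = some y} := fun y => by
    have : {ω | M.pos t ω = some y} =
        ⋃ n, {ω | M.J n ω ≤ t} ∩ {ω | t < M.J (n+1) ω} ∩ {ω | M.jump n ω = y} := by
      ext ω
      simp only [mem_iUnion, mem_inter_iff, mem_ofPred_eq]
      constructor
      · intro h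
        obtain ⟨n, a1, a2, a3⟩ := M.pos_eq_some h
        exact ⟨n, ⟨a1, a2⟩, a3⟩
      · rintro ⟨n, ⟨a1, a2⟩, a3⟩
        rw [M.pos_eq a1 a2, a3]
    rw [this]
    exact MeasurableSet.iUnion fun n => ((measurableSet_le (M.J_meas n) measurable_const).inter
      (measurableSet_lt measurable_const (M.J_meas _))).inter (M.jump_meas n y)
  have h2 : MeasurableSet {ω | M.pos t ω = none} := by
    have : {ω | M.pos t ω = none} = (⋃ y, {ω | M.pos t ω = some y})ᶜ := by
      ext ω
      simp only [mem_ofPred_eq, mem_compl_iff, mem_iUnion]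
      cases M.pos t ω <;> simp
    rw [this]
    exact (MeasurableSet.iUnion h1).compl
  have : {ω | M.pos t ω ∈ D} = ⋃ o ∈ D, {ω | M.pos t ω = o} := by
    ext ω; simp
  rw [this]
  refine MeasurableSet.biUnion (to_countable _) fun o _ => ?_
  cases o with
  | none => exact h2
  | some y => exact h1 y

lemma pos_filt {s t : ℝ≥0} (h : s ≤ t) (D : Set (Option M.X)) :
    MeasurableSet[M.filt t] {ω | M.pos s ω ∈ D} := by
  refine MeasurableSpace.measurableSet_inf.2 ⟨?_, M.pos_meas s D⟩
  have : MeasurableSpace.comap (fun ω => M.pos s ω) ⊤ ≤ M.nat0 t :=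
    le_iSup (fun s : {s : ℝ≥0 // s ≤ t} =>
      MeasurableSpace.comap (fun ω => M.pos ((s : ℝ≥0) : ℝ) ω) ⊤) ⟨s, h⟩
  exact this _ ⟨D, trivial, rfl⟩

/-- trace of the natural filtration on `{s < J (m+1)}` -/
lemma filt_trace (m : ℕ) {s : ℝ≥0} {B : Set M.Ω} (hB : MeasurableSet[M.filt s] B) :
    ∃ E, MeasurableSet[M.G m] E ∧
      B ∩ {ω | (s:ℝ) < M.J (m+1) ω} = E ∩ {ω | (s:ℝ) < M.J (m+1) ω} := by
  set S : Set M.Ω := {ω | (s:ℝ) < M.J (m+1) ω} with hS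
  have hB : MeasurableSet[M.nat0 s] B := by
    exact (MeasurableSpace.measurableSet_inf.1 hB).1
  have hle : M.nat0 s ≤ MeasurableSpace.map (Subtype.val : S → M.Ω)
      (MeasurableSpace.comap (Subtype.val : S → M.Ω) (M.G m)) := by
    refine iSup_le fun u => ?_
    rintro _ ⟨D, _, rfl⟩
    refine ⟨(⋃ k ∈ {k | k < m}, (M.J k ⁻¹' Iic (u:ℝ≥0) ∩ M.J (k+1) ⁻¹' Ioi (u:ℝ≥0)) ∩
      {ω | M.jump k ω ∈ {y | some y ∈ D}}) ∪ (M.J m ⁻¹' Iic (u:ℝ≥0) ∩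
      {ω | M.jump m ω ∈ {y | some y ∈ D}}), ?_, ?_⟩
    · refine MeasurableSet.union (MeasurableSet.biUnion (to_countable _) fun k hk => ?_) ?_
      · have hk : k < m := hk
        exact ((M.J_G hk.le measurableSet_Iic).inter (M.J_G hk measurableSet_Ioi)).inter
          (M.jump_G hk.le _)
      · exact (M.J_G le_rfl measurableSet_Iic).inter (M.jump_G le_rfl _)
    · ext ⟨ω, hω⟩
      have hu : ((u:ℝ≥0):ℝ) < M.J (m+1) ω := lt_of_le_of_lt (by exact_mod_cast u.2) hω
      simp only [mem_preimage, mem_union, mem_iUnion, mem_inter_iff, mem_ofPred_eq, mem_Iic, mem_Ioi]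
      constructor
      · rintro (⟨k, hk, ⟨h1, h2⟩, h3⟩ | ⟨h1, h3⟩)
        · rw [M.pos_eq h1 h2]; exact h3
        · rw [M.pos_eq h1 hu]; exact h3
      · intro h
        obtain ⟨k, hk, h1, h2⟩ := M.exists_index (NNReal.coe_nonneg _) hu
        rw [M.pos_eq h1 h2] at h
        rcases Nat.lt_succ_iff_lt_or_eq.1 hk with hk | rfl
        · exact Or.inl ⟨k, hk, ⟨h1, h2⟩, h⟩
        · exact Or.inr ⟨h1, h⟩
  obtain ⟨E, hE, hE2⟩ := hle _ hB
  refine ⟨E, hE, ?_⟩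
  ext ω
  simp only [mem_inter_iff]
  refine and_congr_left fun hω => ?_
  have := Set.ext_iff.1 hE2 ⟨ω, hω⟩
  exact this.symm

lemma tau_lt_iff (A : Set M.X) (ω : M.Ω) (u : ℝ≥0) :
    M.tau A ω < u ↔ ∃ r : ℚ, 0 ≤ r ∧ (r:ℝ) < u ∧ ∃ y ∈ A, M.pos (r:ℝ) ω = some y := by
  unfold tau
  rw [sInf_lt_iff]
  constructor
  · rintro ⟨_, ⟨s, ⟨hs, y, hy, hp⟩, rfl⟩, hlt⟩
    have hsu : s < u := by
      rw [← ENNReal.ofReal_coe_nnreal] at hlt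
      exact (ENNReal.ofReal_lt_ofReal_iff_of_nonneg hs).1 hlt
    obtain ⟨ε, hε, hc⟩ := M.pos_right_const ω hs
    obtain ⟨r, h1, h2⟩ := exists_rat_btwn (lt_min hsu (lt_add_of_pos_right s hε))
    rw [lt_min_iff] at h2
    have : (0:ℝ) ≤ r := hs.trans h1.le
    refine ⟨r, by exact_mod_cast this, h2.1, y, hy, ?_⟩
    rw [hc r h1.le h2.2, hp]
  · rintro ⟨r, hr, hru, y, hy, hp⟩
    have hr' : (0:ℝ) ≤ r := by exact_mod_cast hr
    refine ⟨_, ⟨r, ⟨hr', y, hy, hp⟩, rfl⟩, ?_⟩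
    rw [← ENNReal.ofReal_coe_nnreal]
    exact (ENNReal.ofReal_lt_ofReal_iff_of_nonneg hr').2 hru

lemma stopT_filt (A : Set M.X) (t : ℝ≥0) : Measurable[M.filt t] (M.stopT A t) := by
  refine @measurable_of_Iio _ _ _ _ _ (M.filt t) _ _ _ _ fun v => ?_
  by_cases hv : v ≤ 0
  · have : M.stopT A t ⁻¹' Iio v = ∅ := by
      ext ω; simp only [mem_preimage, mem_Iio, mem_empty_iff_false, iff_false, not_lt]
      exact hv.trans (M.stopT_nonneg A t ω)
    rw [this]; exact @MeasurableSet.empty _ (M.filt t)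
  push Not at hv
  by_cases hvt : (t:ℝ) < v
  · have : M.stopT A t ⁻¹' Iio v = univ := by
      ext ω; simp only [mem_preimage, mem_Iio, mem_univ, iff_true]
      exact (M.stopT_le A t ω).trans_lt hvt
    rw [this]; exact @MeasurableSet.univ _ (M.filt t)
  push Not at hvt
  lift v to ℝ≥0 using hv.le
  have : M.stopT A t ⁻¹' Iio (v:ℝ) =
      ⋃ r ∈ {r : ℚ | 0 ≤ r ∧ (r:ℝ) < v}, {ω | M.pos (r:ℝ) ω ∈ some '' A} := by
    ext ω
    have e : M.stopT A t ω < v ↔ M.tau A ω < v := by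
      unfold stopT
      rw [NNReal.coe_lt_coe]
      have hne : min (t:ℝ≥0∞) (M.tau A ω) ≠ ⊤ := (min_lt_of_left_lt ENNReal.coe_lt_top).ne
      rw [← ENNReal.coe_lt_coe, ENNReal.coe_toNNReal hne, min_lt_iff]
      constructor
      · rintro (h | h)
        · rw [ENNReal.coe_lt_coe] at h
          exact absurd h (not_lt.2 (by exact_mod_cast hvt))
        · exact h
      · exact Or.inr
    simp only [mem_preimage, mem_Iio, e, tau_lt_iff, mem_iUnion, mem_ofPred_eq, mem_image,
      exists_prop, and_assoc]
    refine exists_congr fun r => and_congr_right fun _ => and_congr_right fun _ => ?_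
    refine exists_congr fun y => and_congr_right fun _ => eq_comm
  rw [this]
  refine MeasurableSet.biUnion (to_countable _) fun r hr => ?_
  have hr0 : (0:ℝ) ≤ r := by exact_mod_cast hr.1
  have := M.pos_filt (s := Real.toNNReal r) (t := t) (by
    rw [← NNReal.coe_le_coe, Real.coe_toNNReal _ hr0]; exact hr.2.le.trans hvt) (some '' A)
  rw [Real.coe_toNNReal _ hr0] at this
  exact this

lemma fpos_filt (f : M.X → ℝ) (A : Set M.X) (t : ℝ≥0) :
    Measurable[M.filt t] (fun ω => (M.pos (M.stopT A t ω) ω).elim 0 f) := by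
  set ρ : ℕ → M.Ω → ℝ := fun k ω => min (t:ℝ) ((⌊((k:ℝ)+1) * M.stopT A t ω⌋₊ + 1 : ℝ) / (k+1)) with hρ
  have hge : ∀ k ω, M.stopT A t ω ≤ ρ k ω := fun k ω => by
    refine le_min (M.stopT_le A t ω) ?_
    rw [le_div_iff₀ (by positivity)]
    have := Nat.lt_floor_add_one (((k:ℝ)+1) * M.stopT A t ω)
    linarith
  have hle : ∀ k ω, ρ k ω ≤ M.stopT A t ω + 1 / ((k:ℝ)+1) := fun k ω => by
    refine (min_le_right _ _).trans ?_
    have h0 := M.stopT_nonneg A t ω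
    have := Nat.floor_le (show 0 ≤ ((k:ℝ)+1) * M.stopT A t ω by positivity)
    rw [div_le_iff₀ (by positivity)]
    have e : (M.stopT A t ω + 1 / ((k:ℝ)+1)) * (k+1) = ((k:ℝ)+1) * M.stopT A t ω + 1 := by
      field_simp
    rw [e]; linarith
  refine @measurable_of_tendsto_metrizable _ _ (M.filt t) _ _ _ _
    (fun k ω => (M.pos (ρ k ω) ω).elim 0 f) _ (fun k => ?_) ?_
  · refine @measurable_of_Iio _ _ _ _ _ (M.filt t) _ _ _ _ fun v => ?_
    have : (fun ω => (M.pos (ρ k ω) ω).elim 0 f) ⁻¹' Iio v =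
      ⋃ j : ℕ, ((fun ω => ⌊((k:ℝ)+1) * M.stopT A t ω⌋₊) ⁻¹' {j}) ∩
        {ω | M.pos (min t ((j + 1 : ℝ≥0) / (k+1)) : ℝ≥0) ω ∈ {o : Option M.X | o.elim 0 f < v}} := by
      ext ω
      simp only [mem_preimage, mem_Iio, mem_iUnion, mem_inter_iff, mem_singleton_iff, mem_ofPred_eq]
      rw [exists_eq_left']
      simp only [hρ]
      push_cast
      rfl
    rw [this]
    refine MeasurableSet.iUnion fun j => MeasurableSet.inter ?_ ?_
    · have hm : Measurable[M.filt t] fun ω => ⌊((k:ℝ)+1) * M.stopT A t ω⌋₊ :=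
        Nat.measurable_floor.comp ((M.stopT_filt A t).const_mul _)
      exact hm (measurableSet_singleton j)
    · exact M.pos_filt (min_le_left _ _) _
  · rw [tendsto_pi_nhds]
    intro ω
    obtain ⟨ε, hε, hc⟩ := M.pos_right_const ω (M.stopT_nonneg A t ω)
    refine tendsto_const_nhds.congr' ?_
    have := (tendsto_one_div_add_atTop_nhds_zero_nat (𝕜 := ℝ)).eventually (gt_mem_nhds hε)
    filter_upwards [this] with k hk
    rw [hc (ρ k ω) (hge k ω) (by linarith [hle k ω])]

lemma Zp_filt (f : M.X → ℝ) (a b q : ℝ) (t : ℝ≥0) : Measurable[M.filt t] (M.Zp f a b q t) := by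
  unfold Zp
  exact (((M.fpos_filt f {y | f y ≤ a} t).pow_const 2).add
    ((M.stopT_filt {y | f y ≤ a} t).const_mul b)).pow_const q

lemma Zp_meas (f : M.X → ℝ) (a b q : ℝ) (t : ℝ≥0) : Measurable (M.Zp f a b q t) :=
  (M.Zp_filt f a b q t).mono (M.filt.le t) le_rfl

end CTMC


namespace CTMC
/-! ### The discrete skeleton -/
variable (M : CTMC)

/-- the event on which the skeleton moves at step `m` -/
def Cm (f : M.X → ℝ) (a : ℝ) (s T : ℝ≥0) (m : ℕ) : Set M.Ω :=
  {ω | M.J m ω ≤ T ∧ (s:ℝ) < M.J (m+1) ω ∧ ∀ k, k ≤ m → ¬ f (M.jump k ω) ≤ a}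

/-- the skeleton process, `Z` at time `(J m ∨ s) ∧ T` -/
noncomputable def Yp (f : M.X → ℝ) (a b q : ℝ) (s T : ℝ≥0) : ℕ → M.Ω → ℝ
  | 0 => M.Zp f a b q s
  | m+1 => fun ω => if ω ∈ M.Cm f a s T m then
      (if (T:ℝ) < M.J (m+1) ω then M.hfun f b q (M.jump m ω) T
        else M.hfun f b q (M.jump (m+1) ω) (M.J (m+1) ω))
      else Yp f a b q s T m ω

lemma Yp_succ (f : M.X → ℝ) (a b q : ℝ) (s T : ℝ≥0) (m : ℕ) (ω : M.Ω) :
    M.Yp f a b q s T (m+1) ω = if ω ∈ M.Cm f a s T m then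
      (if (T:ℝ) < M.J (m+1) ω then M.hfun f b q (M.jump m ω) T
        else M.hfun f b q (M.jump (m+1) ω) (M.J (m+1) ω))
      else M.Yp f a b q s T m ω := rfl

lemma Zp_hit_any (f : M.X → ℝ) (a b q : ℝ) {ω : M.Ω} {m : ℕ} (h : f (M.jump m ω) ≤ a)
    {t t' : ℝ≥0} (ht : M.J m ω ≤ t) (ht' : M.J m ω ≤ t') :
    M.Zp f a b q t ω = M.Zp f a b q t' ω := by
  have hex : ∃ n, f (M.jump n ω) ≤ a := ⟨m, h⟩
  have hN : Nat.find hex ≤ m := Nat.find_le h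
  have h1 : ∀ k, k < Nat.find hex → ¬ f (M.jump k ω) ≤ a := fun k hk => Nat.find_min hex hk
  have hJ := M.J_mono ω hN
  rw [M.Zp_hit f a b q h1 (Nat.find_spec hex) (hJ.trans ht),
    M.Zp_hit f a b q h1 (Nat.find_spec hex) (hJ.trans ht')]

lemma Yp_eq (f : M.X → ℝ) (a b q : ℝ) {s T : ℝ≥0} (hsT : s ≤ T) (m : ℕ) (ω : M.Ω) :
    M.Yp f a b q s T m ω = M.Zp f a b q (Real.toNNReal (min (max (M.J m ω) s) T)) ω := by
  have hsT' : (s:ℝ) ≤ T := by exact_mod_cast hsT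
  induction m with
  | zero =>
    rw [J_zero, max_eq_right (NNReal.coe_nonneg s), min_eq_left hsT', Real.toNNReal_coe]
    rfl
  | succ m ih =>
    have hJ : M.J m ω < M.J (m+1) ω := M.J_strictMono ω (Nat.lt_succ_self m)
    by_cases hC : ω ∈ M.Cm f a s T m
    · obtain ⟨c1, c2, c3⟩ := id hC
      rw [Yp_succ, if_pos hC]
      split_ifs with hT
      · rw [min_eq_right (le_max_of_le_left hT.le), Real.toNNReal_coe, M.Zp_not_hit f a b q c3 c1 hT]
      · push Not at hT
        rw [max_eq_left c2.le, min_eq_left hT]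
        have e : ((Real.toNNReal (M.J (m+1) ω) : ℝ≥0) : ℝ) = M.J (m+1) ω :=
          Real.coe_toNNReal _ (M.J_nonneg _ _)
        by_cases hA : f (M.jump (m+1) ω) ≤ a
        · rw [M.Zp_hit f a b q (fun k hk => c3 k (by omega)) hA (by rw [e])]
        · rw [M.Zp_not_hit f a b q (n := m+1) (fun k hk => ?_) (by rw [e])
            (by rw [e]; exact M.J_strictMono ω (Nat.lt_succ_self _)), e]
          rcases Nat.le_succ_iff.1 hk with h | h
          · exact c3 k h
          · rw [h]; exact hA
    · rw [Yp_succ, if_neg hC, ih]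
      by_cases h1 : M.J m ω ≤ T
      swap
      · push Not at h1
        rw [min_eq_right (le_max_of_le_left h1.le),
          min_eq_right (le_max_of_le_left (h1.le.trans hJ.le))]
      by_cases h2 : (s:ℝ) < M.J (m+1) ω
      swap
      · push Not at h2
        rw [max_eq_right h2, max_eq_right (hJ.le.trans h2)]
      have h3 : ∃ k, k ≤ m ∧ f (M.jump k ω) ≤ a := by
        by_contra hcon
        push Not at hcon
        exact hC ⟨h1, h2, fun k hk => not_le.2 (hcon k hk)⟩
      obtain ⟨k, hk, hka⟩ := h3
      have hJk := M.J_mono ω hk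
      have h0 := M.J_nonneg m ω
      refine M.Zp_hit_any f a b q hka ?_ ?_
      · rw [Real.coe_toNNReal _ (le_min (le_max_of_le_left h0) (NNReal.coe_nonneg T))]
        exact le_min (le_max_of_le_left hJk) (hJk.trans h1)
      · rw [Real.coe_toNNReal _ (le_min (le_max_of_le_left (h0.trans hJ.le)) (NNReal.coe_nonneg T))]
        exact le_min (le_max_of_le_left (hJk.trans hJ.le)) (hJk.trans h1)

lemma Yp_on_Cm (f : M.X → ℝ) (a b q : ℝ) {s T : ℝ≥0} (hsT : s ≤ T) {m : ℕ} {ω : M.Ω}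
    (hC : ω ∈ M.Cm f a s T m) :
    M.Yp f a b q s T m ω = M.hfun f b q (M.jump m ω) (max (M.J m ω) s) := by
  have hsT' : (s:ℝ) ≤ T := by exact_mod_cast hsT
  obtain ⟨c1, c2, c3⟩ := id hC
  have e : ((Real.toNNReal (max (M.J m ω) s) : ℝ≥0) : ℝ) = max (M.J m ω) s :=
    Real.coe_toNNReal _ (le_max_of_le_left (M.J_nonneg _ _))
  rw [M.Yp_eq f a b q hsT, min_eq_left (max_le c1 hsT'), M.Zp_not_hit f a b q c3, e]
  · rw [e]; exact le_max_left _ _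
  · rw [e]; exact max_lt (M.J_strictMono ω (Nat.lt_succ_self m)) c2

lemma fjump_meas (f : M.X → ℝ) (m : ℕ) : Measurable fun ω => f (M.jump m ω) :=
  fun D _ => M.jump_meas' m (f ⁻¹' D)

lemma Cm_meas (f : M.X → ℝ) (a : ℝ) (s T : ℝ≥0) (m : ℕ) : MeasurableSet (M.Cm f a s T m) := by
  refine MeasurableSet.inter (measurableSet_le (M.J_meas m) measurable_const)
    (MeasurableSet.inter (measurableSet_lt measurable_const (M.J_meas _)) ?_)
  have : {ω | ∀ k, k ≤ m → ¬ f (M.jump k ω) ≤ a} =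
    ⋂ k ∈ {k | k ≤ m}, {ω | M.jump k ω ∈ {y | ¬ f y ≤ a}} := by ext ω; simp
  change MeasurableSet {ω | ∀ k, k ≤ m → ¬ f (M.jump k ω) ≤ a}
  rw [this]
  exact MeasurableSet.biInter (to_countable _) fun k _ => M.jump_meas' k _

lemma Yp_meas (f : M.X → ℝ) (a b q : ℝ) (s T : ℝ≥0) (m : ℕ) : Measurable (M.Yp f a b q s T m) := by
  induction m with
  | zero => exact M.Zp_meas f a b q s
  | succ m ih =>
    refine Measurable.ite (M.Cm_meas f a s T m) (Measurable.ite
      (measurableSet_lt measurable_const (M.J_meas _)) ?_ ?_) ih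
    · unfold hfun
      exact (((M.fjump_meas f m).pow_const 2).add_const _).pow_const q
    · unfold hfun
      exact (((M.fjump_meas f (m+1)).pow_const 2).add ((M.J_meas _).const_mul b)).pow_const q

lemma lintegral_fiber (μ : Measure M.Ω) (n : ℕ) {S : Set M.Ω} (hS : MeasurableSet S)
    (F : M.Ω → ℝ≥0∞) : ∫⁻ ω in S, F ω ∂μ = ∑' x, ∫⁻ ω in S ∩ {ω | M.jump n ω = x}, F ω ∂μ := by
  rw [← lintegral_iUnion (fun x => hS.inter (M.jump_meas n x))]
  · congr 2
    ext ω; simp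
  · intro x y hxy
    rw [Function.onFun, Set.disjoint_left]
    rintro ω ⟨_, h1⟩ ⟨_, h2⟩
    exact hxy (h1.symm.trans h2)

open ProbabilityTheory in
lemma step_x (f : M.X → ℝ) (p a c : ℝ) (hf0 : ∀ x, 0 ≤ f x) (hp : 2 ≤ p) (ha : 0 < a)
    (hfp : M.InDom fun x => f x ^ p) (hc : 0 < c)
    (hdrift : ∀ x : M.X, a < f x → M.gen (fun y => f y ^ p) x ≤ -c * f x ^ (p - 2))
    (x : M.X) (hx : a < f x) (b q : ℝ) (hq : q = p / 2) (hb : b = 2 * c / p)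
    {s T : ℝ≥0} (hsT : s ≤ T) (x0 : M.X) (m : ℕ) {E : Set M.Ω} (hE : MeasurableSet[M.G m] E)
    (hET : ∀ ω ∈ E, M.J m ω ≤ T) :
    ∑' y, ∫⁻ ω in E ∩ ({ω | M.jump m ω = x} ∩ {ω | M.jump (m+1) ω = y}),
      (if max (M.J m ω) s < M.J m ω + M.hold m ω then
        (if (T:ℝ) < M.J m ω + M.hold m ω then ENNReal.ofReal (M.hfun f b q x T)
          else ENNReal.ofReal (M.hfun f b q y (M.J m ω + M.hold m ω))) else 0) ∂(M.μ x0) ≤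
    ∑' y, ∫⁻ ω in E ∩ ({ω | M.jump m ω = x} ∩ {ω | M.jump (m+1) ω = y}),
      (if max (M.J m ω) s < M.J m ω + M.hold m ω then
        ENNReal.ofReal (M.hfun f b q x (max (M.J m ω) s)) else 0) ∂(M.μ x0) := by
  have hsT' : (s:ℝ) ≤ T := by exact_mod_cast hsT
  set g : M.X → ℝ × ℝ → ℝ≥0∞ := fun y z => if max z.1 s < z.1 + z.2 then
        (if (T:ℝ) < z.1 + z.2 then ENNReal.ofReal (M.hfun f b q x T)
          else ENNReal.ofReal (M.hfun f b q y (z.1 + z.2))) else 0 with hg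
  set k : ℝ × ℝ → ℝ≥0∞ := fun z => if max z.1 s < z.1 + z.2 then
        ENNReal.ofReal (M.hfun f b q x (max z.1 s)) else 0 with hk
  have hset : MeasurableSet {z : ℝ × ℝ | max z.1 (s:ℝ) < z.1 + z.2} :=
    measurableSet_lt (by fun_prop) (by fun_prop)
  have hgm : ∀ y, Measurable (g y) := fun y => by
    refine Measurable.ite hset (Measurable.ite (measurableSet_lt measurable_const (by fun_prop))
      measurable_const (ENNReal.measurable_ofReal.comp ?_)) measurable_const
    unfold hfun; fun_prop
  have hkm : Measurable k := by
    refine Measurable.ite hset (ENNReal.measurable_ofReal.comp ?_) measurable_const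
    unfold hfun; fun_prop
  have hpr := isProbabilityMeasure_expMeasure (M.γ_pos x)
  have hEx : MeasurableSet (E ∩ {ω | M.jump m ω = x}) := (M.G_le m _ hE).inter (M.jump_meas m x)
  have hind : ∀ r : ℝ, {u | max r (s:ℝ) < r + u} = Ioi (max r s - r) := fun r => by
    ext u; simp only [mem_ofPred_eq, mem_Ioi]; constructor <;> intro h <;> linarith
  calc _ = ∑' y, ENNReal.ofReal (M.P x y) * ∫⁻ ω in E ∩ {ω | M.jump m ω = x},
            ∫⁻ u, g y (M.J m ω, u) ∂(expMeasure (M.γ x)) ∂(M.μ x0) :=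
        tsum_congr fun y => M.markov_lintegral x0 m x y hE (hgm y)
    _ = ∫⁻ ω in E ∩ {ω | M.jump m ω = x}, ∑' y, ENNReal.ofReal (M.P x y) *
            ∫⁻ u, g y (M.J m ω, u) ∂(expMeasure (M.γ x)) ∂(M.μ x0) := by
        have hm1 : ∀ y, Measurable fun ω => ∫⁻ u, g y (M.J m ω, u) ∂(expMeasure (M.γ x)) :=
          fun y => ((hgm y).lintegral_prod_right').comp (M.J_meas m)
        rw [lintegral_tsum fun y => ((hm1 y).const_mul _).aemeasurable]
        exact tsum_congr fun y => (lintegral_const_mul _ (hm1 y)).symm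
    _ ≤ ∫⁻ ω in E ∩ {ω | M.jump m ω = x}, ∫⁻ u, k (M.J m ω, u) ∂(expMeasure (M.γ x)) ∂(M.μ x0) := by
        refine setLIntegral_mono' hEx fun ω hω => ?_
        have hr := M.J_nonneg m ω
        have hrT := hET ω hω.1
        set r := M.J m ω
        have hrw : r ≤ max r s := le_max_left _ _
        have key := M.one_step f p a c hf0 hp ha hfp hc hdrift x hx b q hq hb r (max r s) T hr
          hrw (max_le hrT hsT')
        have e1 : ∀ F : ℝ → ℝ≥0∞, ∫⁻ u, (if max r (s:ℝ) < r + u then F u else 0)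
            ∂(expMeasure (M.γ x)) = ∫⁻ u in Ioi (max r s - r), F u ∂(expMeasure (M.γ x)) := fun F => by
          rw [← lintegral_indicator measurableSet_Ioi, ← hind]
          rfl
        have e2 : ∫⁻ u, k (r, u) ∂(expMeasure (M.γ x)) =
            ENNReal.ofReal (Real.exp (-M.γ x * (max r s - r))) *
              ENNReal.ofReal ((f x ^ 2 + b * max r s) ^ q) := by
          simp only [hk]
          rw [e1, setLIntegral_const, expMeasure_Ioi (M.γ_pos x) (by linarith), mul_comm]
          rfl
        rw [e2]
        refine le_trans (le_of_eq ?_) key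
        refine tsum_congr fun y => ?_
        simp only [hg]
        rw [e1]
        rfl
    _ = ∑' y, ENNReal.ofReal (M.P x y) * ∫⁻ ω in E ∩ {ω | M.jump m ω = x},
            ∫⁻ u, k (M.J m ω, u) ∂(expMeasure (M.γ x)) ∂(M.μ x0) := by
        rw [ENNReal.tsum_mul_right, M.P_tsum, one_mul]
    _ = _ := tsum_congr fun y => (M.markov_lintegral x0 m x y hE hkm).symm

lemma step (f : M.X → ℝ) (p a c : ℝ) (hf0 : ∀ x, 0 ≤ f x) (hp : 2 ≤ p) (ha : 0 < a)
    (hfp : M.InDom fun x => f x ^ p) (hc : 0 < c)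
    (hdrift : ∀ x : M.X, a < f x → M.gen (fun y => f y ^ p) x ≤ -c * f x ^ (p - 2))
    (b q : ℝ) (hq : q = p / 2) (hb : b = 2 * c / p)
    {s T : ℝ≥0} (hsT : s ≤ T) (x0 : M.X) (m : ℕ) {B : Set M.Ω} (hB : MeasurableSet[M.filt s] B) :
    ∫⁻ ω in B, ENNReal.ofReal (M.Yp f a b q s T (m+1) ω) ∂(M.μ x0) ≤
    ∫⁻ ω in B, ENNReal.ofReal (M.Yp f a b q s T m ω) ∂(M.μ x0) := by
  have hBm : MeasurableSet B := M.filt.le s _ hB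
  set C := M.Cm f a s T m with hC
  have hCm : MeasurableSet C := M.Cm_meas f a s T m
  rw [← lintegral_inter_add_sdiff _ B hCm, ← lintegral_inter_add_sdiff (fun ω =>
    ENNReal.ofReal (M.Yp f a b q s T m ω)) B hCm]
  refine add_le_add ?_ (le_of_eq ?_)
  swap
  · refine setLIntegral_congr_fun (hBm.diff hCm) fun ω hω => ?_
    rw [Yp_succ, if_neg hω.2]
  obtain ⟨E0, hE0, hE0B⟩ := M.filt_trace m hB
  set S : Set M.Ω := {ω | (s:ℝ) < M.J (m+1) ω} with hS
  set E : Set M.Ω := E0 ∩ ((M.J m ⁻¹' Iic (T:ℝ)) ∩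
    ⋂ k ∈ {k | k ≤ m}, {ω | M.jump k ω ∈ {y | ¬ f y ≤ a}}) with hE
  have hEG : MeasurableSet[M.G m] E := hE0.inter ((M.J_G le_rfl measurableSet_Iic).inter
    (MeasurableSet.biInter (to_countable _) fun k hk => M.jump_G hk _))
  have hEm := M.G_le m _ hEG
  have hSm : MeasurableSet S := measurableSet_lt measurable_const (M.J_meas _)
  have hBC : B ∩ C = E ∩ S := by
    ext ω
    have := Set.ext_iff.1 hE0B ω
    simp only [mem_inter_iff, hE, hC, hS, Cm, mem_preimage, mem_Iic, mem_iInter, mem_ofPred_eq] at this ⊢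
    tauto
  have hsplit : ∀ F : M.Ω → ℝ≥0∞, ∫⁻ ω in E ∩ S, F ω ∂(M.μ x0) =
      ∑' x, ∑' y, ∫⁻ ω in E ∩ ({ω | M.jump m ω = x} ∩ {ω | M.jump (m+1) ω = y}),
        S.indicator F ω ∂(M.μ x0) := fun F => by
    rw [inter_comm, ← setLIntegral_indicator hSm, M.lintegral_fiber _ m hEm]
    refine tsum_congr fun x => ?_
    rw [M.lintegral_fiber _ (m+1) (hEm.inter (M.jump_meas m x))]
    refine tsum_congr fun y => ?_
    rw [inter_assoc]
  rw [hBC, hsplit, hsplit]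
  refine ENNReal.tsum_le_tsum fun x => ?_
  by_cases hx : a < f x
  swap
  · have he : ∀ y, E ∩ ({ω | M.jump m ω = x} ∩ {ω | M.jump (m+1) ω = y}) = ∅ := fun y => by
      rw [Set.eq_empty_iff_forall_notMem]
      rintro ω ⟨⟨_, _, h1⟩, h2, _⟩
      rw [mem_iInter₂] at h1
      have := h1 m (show m ≤ m from le_rfl)
      simp only [mem_ofPred_eq] at this h2
      rw [h2] at this
      exact hx (not_le.1 this)
    simp [he]
  have hiff : ∀ ω, max (M.J m ω) s < M.J m ω + M.hold m ω ↔ ω ∈ S := fun ω => by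
    have h0 := M.hold_pos m ω
    simp only [hS, mem_ofPred_eq, J_succ, max_lt_iff]
    constructor
    · exact fun h => h.2
    · exact fun h => ⟨by linarith, h⟩
  have hmem : ∀ ω ∈ E, ω ∈ S → ω ∈ C := fun ω h1 h2 => (hBC ▸ (⟨h1, h2⟩ : ω ∈ E ∩ S) : ω ∈ B ∩ C).2
  refine le_trans (le_of_eq ?_) (le_trans (M.step_x f p a c hf0 hp ha hfp hc hdrift x hx b q hq hb
    hsT x0 m hEG fun ω hω => hω.2.1) (le_of_eq ?_))
  · refine tsum_congr fun y => ?_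
    refine setLIntegral_congr_fun (hEm.inter ((M.jump_meas m x).inter (M.jump_meas _ y)))
      fun ω hω => ?_
    obtain ⟨h1, h2, h3⟩ := hω
    have h2 : M.jump m ω = x := h2
    have h3 : M.jump (m+1) ω = y := h3
    by_cases hωS : ω ∈ S
    · rw [indicator_of_mem hωS]
      simp only [(hiff ω).2 hωS, if_true, Yp_succ]
      rw [if_pos (hmem ω h1 hωS), J_succ, h2, h3]
      split_ifs <;> rfl
    · rw [indicator_of_notMem hωS]
      simp only [hiff, hωS, if_false]
  · refine tsum_congr fun y => ?_
    refine setLIntegral_congr_fun (hEm.inter ((M.jump_meas m x).inter (M.jump_meas _ y)))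
      fun ω hω => ?_
    obtain ⟨h1, h2, h3⟩ := hω
    have h2 : M.jump m ω = x := h2
    by_cases hωS : ω ∈ S
    · rw [indicator_of_mem hωS]
      simp only [(hiff ω).2 hωS, if_true]
      rw [M.Yp_on_Cm f a b q hsT (hmem ω h1 hωS), h2]
    · rw [indicator_of_notMem hωS]
      simp only [hiff, hωS, if_false]

end CTMC


namespace CTMC
/-! ### Non-explosion before hitting and conclusion -/
variable (M : CTMC)

lemma markov_hold (x0 : M.X) (k : ℕ) (z : M.X) {E : Set M.Ω} (hE : MeasurableSet[M.G k] E) :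
    M.μ x0 (E ∩ ({ω | M.jump k ω = z} ∩ {ω | 1 < M.hold k ω})) =
      ENNReal.ofReal (Real.exp (-M.γ z)) * M.μ x0 (E ∩ {ω | M.jump k ω = z}) := by
  have hEm := M.G_le k _ hE
  have hS : MeasurableSet (E ∩ ({ω | M.jump k ω = z} ∩ {ω | 1 < M.hold k ω})) :=
    hEm.inter ((M.jump_meas k z).inter (measurableSet_lt measurable_const (M.hold_meas k)))
  have h := M.lintegral_fiber (M.μ x0) (k+1) hS (fun _ => 1)
  simp only [setLIntegral_one] at h
  rw [h]
  have : ∀ y, M.μ x0 (E ∩ ({ω | M.jump k ω = z} ∩ {ω | 1 < M.hold k ω}) ∩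
      {ω | M.jump (k+1) ω = y}) = ENNReal.ofReal (M.P z y) *
        (ENNReal.ofReal (Real.exp (-M.γ z)) * M.μ x0 (E ∩ {ω | M.jump k ω = z})) := fun y => by
    have h2 := M.markov_set x0 k z y (v := 1) zero_le_one hE
    rw [mul_one, ENNReal.ofReal_mul (M.P_nonneg z y), mul_assoc] at h2
    rw [← h2]
    congr 1
    ext ω
    simp only [mem_inter_iff]
    tauto
  simp only [this]
  rw [ENNReal.tsum_mul_right, M.P_tsum, one_mul]

/-- the discrete filtration -/
noncomputable def GF : Filtration ℕ M.measΩ where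
  seq n := M.G n
  mono' _ _ h := M.G_mono h
  le' n := M.G_le n

/-- long holding at `z` -/
def Sz (z : M.X) : ℕ → Set M.Ω
  | 0 => ∅
  | k+1 => {ω | M.jump k ω = z} ∩ {ω | 1 < M.hold k ω}

lemma Sz_meas (z : M.X) (n : ℕ) : MeasurableSet[M.GF n] (M.Sz z n) := by
  cases n with
  | zero => exact @MeasurableSet.empty _ (M.GF 0)
  | succ k =>
    refine MeasurableSet.inter (M.jump_G (Nat.le_succ k) {z}) ?_
    exact M.hold_G (Nat.lt_succ_self k) measurableSet_Ioi

lemma Sz_condExp (x0 z : M.X) (k : ℕ) :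
    {ω | M.jump k ω = z}.indicator (fun _ => Real.exp (-M.γ z)) =ᵐ[M.μ x0]
      (M.μ x0)[(M.Sz z (k+1)).indicator (1 : M.Ω → ℝ) | M.GF k] := by
  have hSm : MeasurableSet (M.Sz z (k+1)) := M.GF.le _ _ (M.Sz_meas z (k+1))
  refine ae_eq_condExp_of_forall_setIntegral_eq (M.GF.le k)
    ((integrable_const (1:ℝ)).indicator hSm) ?_ ?_ ?_
  · intro E _ _
    exact ((integrable_const _).indicator (M.jump_meas k z)).integrableOn
  · intro E hE _
    have hEm := M.GF.le k _ hE
    have e : ((M.Sz z (k+1)).indicator (1 : M.Ω → ℝ)) = (M.Sz z (k+1)).indicator (fun _ => 1) := rfl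
    rw [e, integral_indicator (M.jump_meas k z), integral_indicator hSm, setIntegral_const,
      setIntegral_const, measureReal_restrict_apply (M.jump_meas k z),
      measureReal_restrict_apply hSm, inter_comm, inter_comm (M.Sz z (k+1))]
    have h := M.markov_hold x0 k z hE
    simp only [Measure.real, Sz, h, ENNReal.toReal_mul, smul_eq_mul, mul_one,
      ENNReal.toReal_ofReal (Real.exp_pos _).le]
    ring
  · have : Measurable[M.GF k] ({ω | M.jump k ω = z}.indicator (fun _ => Real.exp (-M.γ z))) :=
      measurable_const.indicator (M.jump_G (le_refl k) {z})
    exact this.stronglyMeasurable.aestronglyMeasurable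

lemma hold_freq (x0 z : M.X) : ∀ᵐ ω ∂(M.μ x0), (∃ᶠ k in atTop, M.jump k ω = z) →
    ∃ᶠ k in atTop, 1 < M.hold k ω := by
  have h1 := ae_mem_limsup_atTop_iff (ℱ := M.GF) (M.μ x0) (M.Sz_meas z)
  have h2 := ae_all_iff.2 (M.Sz_condExp x0 z)
  filter_upwards [h1, h2] with ω h1 h2 hfr
  simp only [← h2] at h1
  have h3 := Set.limsup_eq_tendsto_sum_indicator_atTop (Real.exp_pos (-M.γ z))
    (fun k => {ω | M.jump k ω = z})
  have h4 : ω ∈ limsup (fun k => {ω | M.jump k ω = z}) atTop :=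
    mem_limsup_iff_frequently_mem.2 hfr
  rw [h3] at h4
  have h5 := mem_limsup_iff_frequently_mem.1 (h1.2 h4)
  rw [frequently_atTop] at h5 ⊢
  intro n
  obtain ⟨m, hm, hmS⟩ := h5 (n+1)
  obtain ⟨k, rfl⟩ : ∃ k, m = k + 1 := ⟨m - 1, by omega⟩
  exact ⟨k, by omega, hmS.2⟩

lemma no_freq (T : ℝ) {ω : M.Ω} (h : ∀ n, M.J n ω ≤ T) : ¬ ∃ᶠ k in atTop, 1 < M.hold k ω := by
  have hs : Summable fun k => M.hold k ω :=
    summable_of_sum_range_le (fun n => (M.hold_pos n ω).le) h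
  have := hs.tendsto_atTop_zero.eventually (gt_mem_nhds (zero_lt_one' ℝ))
  intro hf
  obtain ⟨k, h1, h2⟩ := (hf.and_eventually this).exists
  exact lt_asymm h1 h2

lemma iter_step (f : M.X → ℝ) (p a c : ℝ) (hf0 : ∀ x, 0 ≤ f x) (hp : 2 ≤ p) (ha : 0 < a)
    (hfp : M.InDom fun x => f x ^ p) (hc : 0 < c)
    (hdrift : ∀ x : M.X, a < f x → M.gen (fun y => f y ^ p) x ≤ -c * f x ^ (p - 2))
    (b q : ℝ) (hq : q = p / 2) (hb : b = 2 * c / p)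
    {s T : ℝ≥0} (hsT : s ≤ T) (x0 : M.X) {B : Set M.Ω} (hB : MeasurableSet[M.filt s] B) (m : ℕ) :
    ∫⁻ ω in B, ENNReal.ofReal (M.Yp f a b q s T m ω) ∂(M.μ x0) ≤
    ∫⁻ ω in B, ENNReal.ofReal (M.Zp f a b q s ω) ∂(M.μ x0) := by
  induction m with
  | zero => exact le_rfl
  | succ m ih => exact (M.step f p a c hf0 hp ha hfp hc hdrift b q hq hb hsT x0 m hB).trans ih

lemma fatou_step (f : M.X → ℝ) (p a c : ℝ) (hf0 : ∀ x, 0 ≤ f x) (hp : 2 ≤ p) (ha : 0 < a)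
    (hfp : M.InDom fun x => f x ^ p) (hc : 0 < c)
    (hdrift : ∀ x : M.X, a < f x → M.gen (fun y => f y ^ p) x ≤ -c * f x ^ (p - 2))
    (b q : ℝ) (hq : q = p / 2) (hb : b = 2 * c / p)
    {s T : ℝ≥0} (hsT : s ≤ T) (x0 : M.X) {B : Set M.Ω} (hB : MeasurableSet[M.filt s] B) :
    ∫⁻ ω in B, liminf (fun m => ENNReal.ofReal (M.Yp f a b q s T m ω)) atTop ∂(M.μ x0) ≤
    ∫⁻ ω in B, ENNReal.ofReal (M.Zp f a b q s ω) ∂(M.μ x0) := by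
  refine (lintegral_liminf_le fun m => (M.Yp_meas f a b q s T m).ennreal_ofReal).trans ?_
  refine liminf_le_of_le (by isBoundedDefault) fun u hu => ?_
  obtain ⟨m, hm⟩ := hu.exists
  exact hm.trans (M.iter_step f p a c hf0 hp ha hfp hc hdrift b q hq hb hsT x0 hB m)

lemma Zp_zero_fin (f : M.X → ℝ) (a b q : ℝ) (x0 : M.X) :
    ∫⁻ ω, ENNReal.ofReal (M.Zp f a b q 0 ω) ∂(M.μ x0) ≠ ⊤ := by
  have h : ∀ᵐ ω ∂(M.μ x0), M.jump 0 ω = x0 := by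
    exact (prob_compl_eq_zero_iff (M.jump_meas 0 x0)).2 (M.start x0)
  have h2 : ∀ᵐ ω ∂(M.μ x0), ENNReal.ofReal (M.Zp f a b q 0 ω) =
      ENNReal.ofReal (M.hfun f b q x0 0) := by
    filter_upwards [h] with ω hω
    have e0 := M.J_zero ω
    by_cases hA : f (M.jump 0 ω) ≤ a
    · rw [M.Zp_hit f a b q (N := 0) (fun k hk => absurd hk (Nat.not_lt_zero k)) hA
        (by rw [e0]; simp), e0, hω]
    · rw [M.Zp_not_hit f a b q (n := 0) (fun k hk => by rw [Nat.le_zero.1 hk]; exact hA)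
        (by rw [e0]; simp) (by
          have : M.J 0 ω < M.J (0+1) ω := M.J_strictMono ω (Nat.lt_succ_self 0)
          rw [e0] at this; simpa using this), hω]
      simp
  rw [lintegral_congr_ae h2]
  simp

lemma good_ae (f : M.X → ℝ) (hfinf : M.FinSublevels f)
    (p a c : ℝ) (hf0 : ∀ x, 0 ≤ f x) (hp : 2 ≤ p) (ha : 0 < a)
    (hfp : M.InDom fun x => f x ^ p) (hc : 0 < c)
    (hdrift : ∀ x : M.X, a < f x → M.gen (fun y => f y ^ p) x ≤ -c * f x ^ (p - 2))
    (T : ℝ≥0) (x0 : M.X) :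
    ∀ᵐ ω ∂(M.μ x0), (∃ n, (T:ℝ) < M.J n ω) ∨ ∃ N, f (M.jump N ω) ≤ a := by
  have hfat := M.fatou_step f p a c hf0 hp ha hfp hc hdrift (2*c/p) (p/2) rfl rfl
    (zero_le : (0:ℝ≥0) ≤ T) x0 (B := univ) (@MeasurableSet.univ _ (M.filt 0))
  simp only [Measure.restrict_univ] at hfat
  have hlt := ae_lt_top (Measurable.liminf fun m =>
    (M.Yp_meas f a (2*c/p) (p/2) 0 T m).ennreal_ofReal)
    (ne_top_of_le_ne_top (M.Zp_zero_fin f a (2*c/p) (p/2) x0) hfat)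
  have hfr := ae_all_iff.2 (M.hold_freq x0)
  filter_upwards [hlt, hfr] with ω hlt hfr
  by_contra hcon
  push Not at hcon
  obtain ⟨hJ, hA⟩ := hcon
  obtain ⟨K, hK⟩ := ENNReal.exists_nat_gt hlt.ne
  have hfreq := frequently_lt_of_liminf_lt (by isBoundedDefault) hK
  have hb : 0 ≤ 2*c/p := by positivity
  have hle : ∃ᶠ m in atTop, f (M.jump m ω) ≤ max 1 (K:ℝ) := by
    refine hfreq.mono fun m hm => ?_
    by_contra hgt
    push Not at hgt
    obtain ⟨h1, h2⟩ := max_lt_iff.1 hgt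
    have hJ0 := M.J_nonneg m ω
    have e : ((Real.toNNReal (M.J m ω) : ℝ≥0) : ℝ) = M.J m ω := Real.coe_toNNReal _ hJ0
    rw [M.Yp_eq f a _ _ zero_le, NNReal.coe_zero, max_eq_left hJ0, min_eq_left (hJ m),
      M.Zp_not_hit f a _ _ (n := m) (fun k _ => not_le.2 (hA k)) (by rw [e])
        (by rw [e]; exact M.J_strictMono ω (Nat.lt_succ_self m)), e,
      ENNReal.ofReal_lt_natCast (by
        rintro rfl
        simp at hm)] at hm
    have hbase : f (M.jump m ω) ≤ f (M.jump m ω)^2 + 2*c/p * M.J m ω := by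
      have := mul_nonneg hb hJ0
      nlinarith
    have := Real.self_le_rpow_of_one_le (h1.le.trans hbase) (show (1:ℝ) ≤ p/2 by linarith)
    unfold hfun at hm
    linarith
  have hz : ∃ z, ∃ᶠ m in atTop, M.jump m ω = z := by
    by_contra hno
    push Not at hno
    have : ∀ᶠ m in atTop, ∀ z ∈ {x | f x ≤ max 1 (K:ℝ)}, M.jump m ω ≠ z :=
      (eventually_all_finite (hfinf _)).2 fun z _ => hno z
    obtain ⟨m, h1, h2⟩ := (hle.and_eventually this).exists
    exact h2 _ h1 rfl
  obtain ⟨z, hz⟩ := hz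
  exact M.no_freq T hJ (hfr z hz)

lemma main_ineq (f : M.X → ℝ) (hfinf : M.FinSublevels f)
    (p a c : ℝ) (hf0 : ∀ x, 0 ≤ f x) (hp : 2 ≤ p) (ha : 0 < a)
    (hfp : M.InDom fun x => f x ^ p) (hc : 0 < c)
    (hdrift : ∀ x : M.X, a < f x → M.gen (fun y => f y ^ p) x ≤ -c * f x ^ (p - 2))
    {s T : ℝ≥0} (hsT : s ≤ T) (x0 : M.X) {B : Set M.Ω} (hB : MeasurableSet[M.filt s] B) :
    ∫⁻ ω in B, ENNReal.ofReal (M.Zp f a (2*c/p) (p/2) T ω) ∂(M.μ x0) ≤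
    ∫⁻ ω in B, ENNReal.ofReal (M.Zp f a (2*c/p) (p/2) s ω) ∂(M.μ x0) := by
  refine le_trans (le_of_eq ?_)
    (M.fatou_step f p a c hf0 hp ha hfp hc hdrift (2*c/p) (p/2) rfl rfl hsT x0 hB)
  refine lintegral_congr_ae (ae_restrict_of_ae ?_)
  filter_upwards [M.good_ae f hfinf p a c hf0 hp ha hfp hc hdrift T x0] with ω hω
  symm
  refine Tendsto.liminf_eq (tendsto_const_nhds.congr' ?_)
  have hlarge : ∀ n, (T:ℝ) < M.J n ω → ∀ᶠ m in atTop,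
      ENNReal.ofReal (M.Zp f a (2*c/p) (p/2) T ω) =
        ENNReal.ofReal (M.Yp f a (2*c/p) (p/2) s T m ω) := fun n hn => by
    filter_upwards [eventually_ge_atTop n] with m hm
    rw [M.Yp_eq f a _ _ hsT, min_eq_right (le_max_of_le_left (hn.le.trans (M.J_mono ω hm))),
      Real.toNNReal_coe]
  by_cases hJ : ∃ n, (T:ℝ) < M.J n ω
  · obtain ⟨n, hn⟩ := hJ
    exact hlarge n hn
  · obtain ⟨N, hN⟩ := hω.resolve_left hJ
    push Not at hJ
    filter_upwards [eventually_ge_atTop N] with m hm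
    rw [M.Yp_eq f a _ _ hsT]
    congr 1
    refine M.Zp_hit_any f a _ _ hN (hJ N) ?_
    have h1 := M.J_mono ω hm
    rw [Real.coe_toNNReal _ (le_min (le_max_of_le_left (M.J_nonneg m ω)) (NNReal.coe_nonneg T))]
    exact le_min (le_max_of_le_left h1) (hJ N)

lemma main_super (f : M.X → ℝ) (hfinf : M.FinSublevels f)
    (p a c : ℝ) (hf0 : ∀ x, 0 ≤ f x) (hp : 2 ≤ p) (ha : 0 < a)
    (hfp : M.InDom fun x => f x ^ p) (hc : 0 < c)
    (hdrift : ∀ x : M.X, a < f x → M.gen (fun y => f y ^ p) x ≤ -c * f x ^ (p - 2))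
    (x0 : M.X) :
    Supermartingale (fun (t : ℝ≥0) ω => M.Zp f a (2*c/p) (p/2) t ω) M.filt (M.μ x0) := by
  have hb : 0 ≤ 2*c/p := by positivity
  have h0 := M.Zp_nonneg f a (2*c/p) (p/2) hb
  have hfin : ∀ t, ∫⁻ ω, ENNReal.ofReal (M.Zp f a (2*c/p) (p/2) t ω) ∂(M.μ x0) ≠ ⊤ := fun t => by
    have := M.main_ineq f hfinf p a c hf0 hp ha hfp hc hdrift (zero_le : (0:ℝ≥0) ≤ t) x0
      (B := univ) (@MeasurableSet.univ _ (M.filt 0))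
    simp only [Measure.restrict_univ] at this
    exact ne_top_of_le_ne_top (M.Zp_zero_fin f a (2*c/p) (p/2) x0) this
  have hZint : ∀ t, Integrable (M.Zp f a (2*c/p) (p/2) t) (M.μ x0) := fun t =>
    ⟨(M.Zp_meas f a _ _ t).aestronglyMeasurable, by
      rw [hasFiniteIntegral_iff_ofReal (ae_of_all _ (h0 t))]
      exact (hfin t).lt_top⟩
  have hsub : Submartingale (fun (t : ℝ≥0) ω => - M.Zp f a (2*c/p) (p/2) t ω) M.filt (M.μ x0) := by
    refine submartingale_of_setIntegral_le (fun t => ?_) (fun t => (hZint t).neg) ?_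
    · exact (M.Zp_filt f a _ _ t).neg.stronglyMeasurable
    · intro s t hst B hB
      rw [integral_neg, integral_neg, neg_le_neg_iff,
        integral_eq_lintegral_of_nonneg_ae (ae_of_all _ (h0 t))
          (M.Zp_meas f a _ _ t).aestronglyMeasurable,
        integral_eq_lintegral_of_nonneg_ae (ae_of_all _ (h0 s))
          (M.Zp_meas f a _ _ s).aestronglyMeasurable]
      refine ENNReal.toReal_mono ?_
        (M.main_ineq f hfinf p a c hf0 hp ha hfp hc hdrift hst x0 hB)
      exact ne_top_of_le_ne_top (hfin s) (setLIntegral_le_lintegral _ _)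
  have := hsub.neg
  have e : (-fun (t : ℝ≥0) ω => - M.Zp f a (2*c/p) (p/2) t ω) =
      fun (t : ℝ≥0) ω => M.Zp f a (2*c/p) (p/2) t ω := by
    funext t ω
    exact neg_neg _
  rw [e] at this
  exact this

end CTMC

open CTMC in
/-- Lemma: under the drift condition `Γ f^p ≤ -c f^(p-2)` off `A = {f ≤ a}`
(`p ≥ 2`), the process `Z_t = (X_{t∧τ_A}² + (2c/p)(t∧τ_A))^{p/2}`, where
`X_t = f(ξ_t)`, is a nonnegative supermartingale for the natural filtration. -/
theorem statement11 (M : CTMC) (f : M.X → ℝ) (hf : M.InDomPos f) (hfinf : M.FinSublevels f)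
    (p a : ℝ) (hp : 2 ≤ p) (ha : 0 < a)
    (hfp : M.InDomPos fun x => f x ^ p)
    (c : ℝ) (hc : 0 < c)
    (hdrift : ∀ x : M.X, a < f x → M.gen (fun y => f y ^ p) x ≤ -c * f x ^ (p - 2)) :
    ∀ x : M.X,
      MeasureTheory.Supermartingale
        (fun (t : ℝ≥0) (ω : M.Ω) =>
          (((M.pos (((min (t : ℝ≥0∞) (M.tau {y | f y ≤ a} ω)).toNNReal : ℝ≥0) : ℝ) ω).elim 0 f) ^ 2
            + (2 * c / p) * (((min (t : ℝ≥0∞) (M.tau {y | f y ≤ a} ω)).toNNReal : ℝ≥0) : ℝ)) ^ (p / 2))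
        M.filt (M.μ x)
      ∧ ∀ (t : ℝ≥0) (ω : M.Ω),
          0 ≤ (((M.pos (((min (t : ℝ≥0∞) (M.tau {y | f y ≤ a} ω)).toNNReal : ℝ≥0) : ℝ) ω).elim 0 f) ^ 2
            + (2 * c / p) * (((min (t : ℝ≥0∞) (M.tau {y | f y ≤ a} ω)).toNNReal : ℝ≥0) : ℝ)) ^ (p / 2) := by
  intro x
  exact ⟨M.main_super f hfinf p a c hf.1 hp ha hfp.2 hc hdrift x,
    fun t ω => M.Zp_nonneg f a (2 * c / p) (p / 2) (by positivity) t ω⟩
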